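/- arXiv:1708.07331 — 6 statements merged into one kernel-verified Lean document; each statement's English description precedes it below -/
import Mathlib

section
/- Let G be a finite group and let p and q be distinct primes dividing |G|. Then p·q divides the order of some element of G if and only if p·q divides the order of some element of G that does not lie in the Frattini subgroup of G. (Equivalently, the prime graph Γ(G) and the non-Frattini prime graph Γ̃(G) coincide.) -/
open Finset in
/-- If `x` and `z` are commuting operators with `x ^ r = z ^ r = 1` and no operator `x * z ^ i`
has a nonzero fixed vector inside the fixed space of `d`, then `z` fixes the fixed space of `d`
pointwise. -/
theorem AddMonoid.End.fixed_of_free_cosets {A : Type*} [AddCommGroup A] {r : ℕ} (hr : r.Prime)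
    (hA : ∀ a : A, r • a = 0 → a = 0) {x z d : AddMonoid.End A} (hxz : Commute x z)
    (hdx : Commute d x) (hdz : Commute d z) (hx : x ^ r = 1) (hz : z ^ r = 1)
    (hfree : ∀ i : ℕ, ∀ w : A, d w = w → (x * z ^ i) w = w → w = 0) {v : A} (hv : d v = v) :
    z v = v := by
  have hmul : ∀ (S T : AddMonoid.End A) (a : A), S (T a) = (S * T) a := fun _ _ _ ↦ rfl
  have hpow : ∀ i : ℕ, (x * z ^ i) ^ r = 1 := fun i ↦ by
    rw [(hxz.pow_right i).mul_pow, hx, ← pow_mul, mul_comm i r, pow_mul, hz, one_pow, mul_one]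
  have hzero : ∀ i : ℕ, (∑ j ∈ range r, (x * z ^ i) ^ j) v = 0 := fun i ↦ by
    apply hfree i
    · have : Commute d (∑ j ∈ range r, (x * z ^ i) ^ j) :=
        Commute.sum_right _ _ _ fun j _ ↦ (hdx.mul_right (hdz.pow_right i)).pow_right j
      rw [hmul, this.eq, ← hmul, hv]
    · have h := mul_geom_sum (x * z ^ i) r
      rw [hpow, sub_self, sub_mul, one_mul, sub_eq_zero] at h
      rw [hmul, h]
  have hkill : ∀ j ∈ range r, j ≠ 0 → (z - 1) * ∑ i ∈ range r, (z ^ j) ^ i = 0 := fun j hj hj0 ↦ by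
    have hcop : Nat.Coprime j (orderOf z) :=
      (Nat.coprime_of_lt_prime (n := j) hj0 (mem_range.1 hj) hr).symm.coprime_dvd_right
        (orderOf_dvd_of_pow_eq_one hz)
    obtain ⟨k, hzk⟩ := exists_pow_eq_self_of_coprime hcop
    have h1 := mul_geom_sum (z ^ j) r
    rw [← pow_mul, mul_comm j r, pow_mul, hz, one_pow, sub_self] at h1
    have h2 := geom_sum_mul (z ^ j) k
    rw [hzk] at h2
    rw [← h2, mul_assoc, h1, mul_zero]
  have hsum : (z - 1) * ∑ i ∈ range r, ∑ j ∈ range r, (x * z ^ i) ^ j = r • (z - 1) := by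
    rw [sum_comm, mul_sum, sum_eq_single_of_mem 0 (mem_range.2 hr.pos)]
    · simp [Nat.cast_comm]
    · intro j hj hj0
      have : ∀ i ∈ range r, (x * z ^ i) ^ j = x ^ j * (z ^ j) ^ i := fun i _ ↦ by
        rw [(hxz.pow_right i).mul_pow, ← pow_mul, mul_comm i j, pow_mul]
      have hc : Commute (z - 1) (x ^ j) :=
        ((hxz.symm.sub_left (Commute.one_left _))).pow_right j
      rw [sum_congr rfl this, ← mul_sum, ← mul_assoc, hc.eq, mul_assoc, hkill j hj hj0, mul_zero]
  have h := congrArg (fun T : AddMonoid.End A ↦ T v) hsum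
  have h0 : (∑ i ∈ range r, ∑ j ∈ range r, (x * z ^ i) ^ j) v = 0 := by
    exact (map_sum (AddMonoidHom.eval v) _ _).trans (sum_eq_zero fun i _ ↦ hzero i)
  simp only [← hmul, h0, map_zero] at h
  exact sub_eq_zero.1 (hA _ h.symm)

theorem AddMonoid.End.exists_fixed_of_pow_prime_pow {A : Type*} [AddCommGroup A] [Nontrivial A]
    {p : ℕ} (hp : p.Prime) (hA : ∀ a : A, p • a = 0) {T : AddMonoid.End A} {k : ℕ}
    (hT : T ^ p ^ k = 1) : ∃ a ≠ 0, T a = a := by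
  have : Fact p.Prime := ⟨hp⟩
  obtain ⟨b, hb⟩ := exists_ne (0 : A)
  have : Nontrivial (AddMonoid.End A) :=
    ⟨1, 0, fun h ↦ hb (DFunLike.congr_fun h b)⟩
  have : CharP (AddMonoid.End A) p := by
    rw [CharP.charP_iff_prime_eq_zero hp]
    ext a
    simpa using hA a
  have hnil : (T - 1) ^ p ^ k = 0 := by
    rw [sub_pow_char_pow_of_commute _ _ (Commute.one_right T), hT, one_pow, sub_self]
  by_contra! H
  have hinj : ∀ n : ℕ, ∀ a : A, a ≠ 0 → ((T - 1) ^ n) a ≠ 0 := fun n ↦ by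
    induction n with
    | zero => exact fun a ha ↦ ha
    | succ n ih =>
      intro a ha
      rw [pow_succ]
      exact ih _ fun h ↦ H a ha (sub_eq_zero.1 h)
  exact hinj _ b hb (by rw [hnil]; rfl)

/-- `ρ g` fixes a nonzero vector. -/
def HasFixedVector {L A : Type*} [Group L] [AddCommGroup A] (ρ : L →* AddMonoid.End A) (g : L) :
    Prop :=
  ∃ a ≠ 0, ρ g a = a

/-- A representation on a nontrivial group of exponent `p` all of whose nontrivial restrictions
to elements are nontrivial, unless the whole representation is trivial. -/
structure IsRigidRep {L A : Type*} [Group L] [AddCommGroup A] (p : ℕ)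
    (ρ : L →* AddMonoid.End A) : Prop where
  prime : p.Prime
  nontrivial : Nontrivial A
  nsmul_eq_zero : ∀ a : A, p • a = 0
  rigid : ∀ g : L, g ≠ 1 → ρ g = 1 → ∀ h, ρ h = 1

section

variable {L A : Type*} [Group L] [AddCommGroup A] {ρ : L →* AddMonoid.End A} {p r : ℕ}

theorem HasFixedVector.conj {g : L} (h : HasFixedVector ρ g) (u : L) :
    HasFixedVector ρ (u * g * u⁻¹) := by
  obtain ⟨a, ha, hga⟩ := h
  have hmul : ∀ (s t : L) (a : A), ρ s (ρ t a) = ρ (s * t) a := fun s t a ↦ by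
    rw [map_mul]; rfl
  refine ⟨ρ u a, fun h0 ↦ ha ?_, ?_⟩
  · have := hmul u⁻¹ u a
    rw [h0, map_zero, inv_mul_cancel, map_one] at this
    exact this.symm
  · rw [hmul, inv_mul_cancel_right, ← hmul, hga]

theorem nsmul_injective_of_prime_ne (hp : p.Prime) (hr : r.Prime) (hne : r ≠ p)
    (hA : ∀ a : A, p • a = 0) (a : A) (ha : r • a = 0) : a = 0 := by
  have h1 := addOrderOf_dvd_of_nsmul_eq_zero ha
  have h2 := addOrderOf_dvd_of_nsmul_eq_zero (hA a)
  have := Nat.dvd_gcd h1 h2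
  rw [(Nat.coprime_primes hr hp).2 hne, Nat.dvd_one, AddMonoid.addOrderOf_eq_one_iff] at this
  exact this

theorem IsRigidRep.hasFixedVector_of_pow_eq_one (h : IsRigidRep p ρ) {g : L} {k : ℕ}
    (hg : g ^ p ^ k = 1) : HasFixedVector ρ g := by
  have := h.nontrivial
  exact AddMonoid.End.exists_fixed_of_pow_prime_pow h.prime h.nsmul_eq_zero
    (by rw [← map_pow, hg, map_one])

theorem HasFixedVector.of_map_eq_one [Nontrivial A] {g : L} (h : ρ g = 1) :
    HasFixedVector ρ g := by
  obtain ⟨b, hb⟩ := exists_ne (0 : A)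
  exact ⟨b, hb, by rw [h]; rfl⟩

theorem IsRigidRep.exists_hasFixedVector (h : IsRigidRep p ρ) (hr : r.Prime) {x z : L}
    (hxz : Commute x z) (hx : x ^ r = 1) (hz : z ^ r = 1) (hz1 : z ≠ 1) :
    ∃ i : ℕ, HasFixedVector ρ (x * z ^ i) := by
  have := h.nontrivial
  by_cases hrp : r = p
  · subst hrp
    exact ⟨0, h.hasFixedVector_of_pow_eq_one (k := 1) (by simpa using hx)⟩
  by_contra! H
  have hρz : ρ z = 1 := by
    ext v
    refine AddMonoid.End.fixed_of_free_cosets (d := 1) hr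
      (nsmul_injective_of_prime_ne h.prime hr hrp h.nsmul_eq_zero) (hxz.map ρ)
      (Commute.one_left _) (Commute.one_left _) (by rw [← map_pow, hx, map_one])
      (by rw [← map_pow, hz, map_one]) (fun i w _ hw ↦ ?_) rfl
    by_contra hw0
    exact H i ⟨w, hw0, by rwa [map_mul, map_pow]⟩
  exact H 0 (.of_map_eq_one (h.rigid z hz1 hρz _))

end

section

variable {L A B : Type*} [Group L] [AddCommGroup A] [AddCommGroup B] {p q r : ℕ}
  {ρ : L →* AddMonoid.End A} {τ : L →* AddMonoid.End B}

theorem false_of_isConj_mul_pow (hρ : IsRigidRep p ρ) (hτ : IsRigidRep q τ)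
    (hstar : ∀ g : L, HasFixedVector ρ g → HasFixedVector τ g → g = 1) (hr : r.Prime) {x z : L}
    (hxz : Commute x z) (hx : x ^ r = 1) (hz : z ^ r = 1) (hz1 : z ≠ 1)
    (hconj : ∀ i : ℕ, IsConj (x * z ^ i) x) : False := by
  have key : x = 1 := by
    obtain ⟨i, hi⟩ := hρ.exists_hasFixedVector hr hxz hx hz hz1
    obtain ⟨j, hj⟩ := hτ.exists_hasFixedVector hr hxz hx hz hz1
    obtain ⟨u, hu⟩ := isConj_iff.1 (hconj i)
    obtain ⟨w, hw⟩ := isConj_iff.1 (hconj j)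
    exact hstar x (hu ▸ hi.conj u) (hw ▸ hj.conj w)
  subst key
  exact hz1 (by simpa using hconj 1)

theorem false_of_rank_three (hρ : IsRigidRep p ρ) (hτ : IsRigidRep q τ)
    (hstar : ∀ g : L, HasFixedVector ρ g → HasFixedVector τ g → g = 1) (hr : r.Prime) {a b c : L}
    (hab : Commute a b) (hac : Commute a c) (hbc : Commute b c) (ha : a ^ r = 1) (hb : b ^ r = 1)
    (hc : c ^ r = 1) (hb1 : b ≠ 1) (hab' : ∀ i : ℕ, a ≠ b ^ i)
    (habc : ∀ i j : ℕ, c ≠ a ^ i * b ^ j) : False := by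
  have := hτ.nontrivial
  have hinv : ∀ {g : L}, g ^ r = 1 → ∀ k : ℕ, (g ^ k)⁻¹ = g ^ ((r - 1) * k) := fun {g} hg k ↦ by
    rw [inv_eq_iff_mul_eq_one, ← pow_add, ← one_add_mul, Nat.add_sub_cancel' hr.one_le, pow_mul,
      hg, one_pow]
  obtain ⟨i, hd⟩ := hτ.exists_hasFixedVector hr hab ha hb hb1
  set d := a * b ^ i with hd_def
  have hd1 : d ^ r = 1 := by
    rw [(hab.pow_right i).mul_pow, ha, ← pow_mul, mul_comm i r, pow_mul, hb, one_pow, one_mul]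
  have hd0 : d ≠ 1 := fun h ↦ hab' _ ((eq_inv_of_mul_eq_one_left h).trans (hinv hb i))
  have hdb : Commute d b := hab.mul_left (Commute.pow_self b i)
  have hdc : Commute d c := hac.mul_left (hbc.pow_left i)
  have hdpow : ∀ k : ℕ, d ^ k = a ^ k * b ^ (i * k) := fun k ↦ by
    rw [(hab.pow_right i).mul_pow, pow_mul]
  -- an element `e` all of whose translates by powers of `d` are nontrivial with a fixed vector
  obtain ⟨e, hed, her, hne, hfix⟩ : ∃ e : L, Commute e d ∧ e ^ r = 1 ∧ (∀ k : ℕ, e * d ^ k ≠ 1) ∧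
      ∀ k : ℕ, HasFixedVector τ (e * d ^ k) := by
    have hbne : ∀ k : ℕ, b * d ^ k ≠ 1 := fun k h ↦ by
      have hk : ¬ r ∣ k := by
        rintro ⟨m, rfl⟩
        rw [pow_mul, hd1, one_pow, mul_one] at h
        exact hb1 h
      have hak : a ^ k = b ^ ((r - 1) * (i * k + 1)) := by
        rw [← hinv hb, eq_inv_iff_mul_eq_one, pow_succ, ← mul_assoc, ← hdpow, ← h, (hdb.pow_left k).eq]
      obtain ⟨m, hm⟩ := exists_pow_eq_self_of_coprime (x := a) (n := k)
        (((hr.coprime_iff_not_dvd.2 hk).symm).coprime_dvd_right (orderOf_dvd_of_pow_eq_one ha))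
      rw [hak, ← pow_mul] at hm
      exact hab' _ hm.symm
    by_cases hrq : r = q
    · subst hrq
      refine ⟨b, hdb.symm, hb, hbne, fun k ↦ hτ.hasFixedVector_of_pow_eq_one (k := 1) ?_⟩
      rw [pow_one, (hdb.symm.pow_right k).mul_pow, hb, ← pow_mul, mul_comm k, pow_mul, hd1,
        one_pow, one_mul]
    obtain ⟨w, hw0, hw⟩ := hd
    have htrans : ∀ (e : L) (v : B), τ d v = v → τ e v = v → ∀ k : ℕ, τ (e * d ^ k) v = v := by
      intro e v hdv hev k
      have : (τ d ^ k) v = v := by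
        induction k with
        | zero => rfl
        | succ k ih =>
          rw [pow_succ]
          exact (congrArg (τ d ^ k) hdv).trans ih
      rw [map_mul, map_pow]
      exact (congrArg (τ e) this).trans hev
    by_cases H : ∀ j : ℕ, ∀ v : B, τ d v = v → (τ c * τ b ^ j) v = v → v = 0
    · have hbw : τ b w = w := AddMonoid.End.fixed_of_free_cosets hr
        (nsmul_injective_of_prime_ne hτ.prime hr hrq hτ.nsmul_eq_zero) (hbc.symm.map τ)
        (hdc.map τ) (hdb.map τ) (by rw [← map_pow, hc, map_one])
        (by rw [← map_pow, hb, map_one]) H hw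
      exact ⟨b, hdb.symm, hb, hbne, fun k ↦ ⟨w, hw0, htrans b w hw hbw k⟩⟩
    · push Not at H
      obtain ⟨j, v, hdv, hv, hv0⟩ := H
      rw [← map_pow, ← map_mul] at hv
      refine ⟨c * b ^ j, (hdc.mul_right (hdb.pow_right j)).symm, ?_, fun k hk ↦ ?_,
        fun k ↦ ⟨v, hv0, htrans _ v hdv hv k⟩⟩
      · rw [(hbc.symm.pow_right j).mul_pow, hc, ← pow_mul, mul_comm j r, pow_mul, hb, one_pow,
          one_mul]
      · rw [mul_assoc, hdpow, ((hab.symm.pow_left j).pow_right k).left_comm, ← pow_add,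
          mul_eq_one_iff_eq_inv, mul_inv_rev, hinv ha, hinv hb,
          ((hab.symm.pow_left _).pow_right _).eq] at hk
        exact habc _ _ hk
  obtain ⟨k, hk⟩ := hρ.exists_hasFixedVector hr hed her hd1 hd0
  exact hne k (hstar _ hk (hfix k))

end

section

open scoped commutatorElement

section

variable {D : Type*} [Group D]

theorem mul_pow_of_mul_eq_central {u w c : D} (hc : c ∈ Subgroup.center D) (h : w * u = c * (u * w))
    (m : ℕ) : w ^ m * u = c ^ m * (u * w ^ m) ∧
      (u * w) ^ m = c ^ (m.choose 2) * (u ^ m * w ^ m) := by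
  have hcc : ∀ (k : ℕ) (g : D), g * c ^ k = c ^ k * g := fun k g ↦
    Subgroup.mem_center_iff.1 (pow_mem hc k) g
  have h1 : ∀ m : ℕ, w ^ m * u = c ^ m * (u * w ^ m) := fun m ↦ by
    induction m with
    | zero => simp
    | succ m ih =>
      rw [pow_succ, mul_assoc, h, ← mul_assoc, ← pow_one c, hcc 1, mul_assoc, ← mul_assoc (w ^ m) u,
        ih, pow_one, ← mul_assoc, ← mul_assoc, ← pow_succ', mul_assoc, mul_assoc, ← pow_succ]
  refine ⟨h1 m, ?_⟩
  induction m with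
  | zero => simp
  | succ m ih =>
    rw [pow_succ, ih, Nat.choose_succ_succ', Nat.choose_one_right, add_comm m, pow_add,
      mul_assoc, mul_assoc, ← mul_assoc (w ^ m), h1, mul_assoc, mul_assoc, ← mul_assoc (u ^ m), hcc m,
      mul_assoc, pow_succ u, pow_succ w]
    simp only [mul_assoc]

theorem pow_eq_one_and_commutator_mem_center_of_minimal_mulAut [Finite D] {r : ℕ} (hr : r.Prime)
    (hr2 : r ≠ 2) (hD : IsPGroup r D) {σ : MulAut D} (hσ1 : σ ≠ 1) {n : ℕ} (hσ : σ ^ n = 1)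
    (hn : r.Coprime n)
    (hmin : ∀ K : Subgroup D, K ≠ ⊤ → (∀ k ∈ K, σ k ∈ K) → ∀ k ∈ K, σ k = k) :
    (∀ x : D, x ^ r = 1) ∧ ∀ x y : D, ⁅x, y⁆ ∈ Subgroup.center D := by
  have : Fact r.Prime := ⟨hr⟩
  have : Group.IsNilpotent D := hD.isNilpotent
  have : Nontrivial D := by
    by_contra h
    rw [not_nontrivial_iff_subsingleton] at h
    exact hσ1 (MulEquiv.ext fun x ↦ Subsingleton.elim _ _)
  set E : Subgroup D := Subgroup.closure (Set.range fun x ↦ x⁻¹ * σ x) with hE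
  have hmemE : ∀ x, x⁻¹ * σ x ∈ E := fun x ↦ Subgroup.subset_closure ⟨x, rfl⟩
  have hEtop : E = ⊤ := by
    by_contra hne
    have hinv : ∀ k ∈ E, σ k ∈ E := by
      intro k hk
      have : E ≤ E.comap σ.toMonoidHom := by
        rw [hE, Subgroup.closure_le]
        rintro _ ⟨x, rfl⟩
        have := hmemE (σ x)
        rw [← map_inv, ← map_mul] at this
        exact this
      exact this hk
    have hfix := hmin E hne hinv
    apply hσ1
    ext x
    set c := x⁻¹ * σ x with hc
    have hx : σ x = x * c := by rw [hc, mul_inv_cancel_left]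
    have hk : ∀ k : ℕ, (σ ^ k) x = x * c ^ k := fun k ↦ by
      induction k with
      | zero => simp
      | succ k ih => rw [pow_succ', MulAut.mul_apply, ih, map_mul, map_pow, hfix c (hmemE x), hx,
          mul_assoc, ← pow_succ']
    have hcn : c ^ n = 1 := by
      have := hk n
      rw [hσ, MulAut.one_apply] at this
      exact (mul_eq_left.1 this.symm)
    obtain ⟨k, hk⟩ := hD c
    have hc1 : c = 1 := orderOf_eq_one_iff.1 (Nat.eq_one_of_dvd_coprimes (hn.pow_left k)
      (orderOf_dvd_of_pow_eq_one hk) (orderOf_dvd_of_pow_eq_one hcn))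
    rw [hx, hc1, mul_one, MulAut.one_apply]
  have hcentral : ∀ K : Subgroup D, K.Normal → K ≠ ⊤ → (∀ k ∈ K, σ k ∈ K) →
      K ≤ Subgroup.center D := by
    intro K hK hKtop hinv c hc
    have hfix := hmin K hKtop hinv
    have : E ≤ Subgroup.centralizer {c} := by
      rw [hE, Subgroup.closure_le]
      rintro _ ⟨x, rfl⟩
      have h1 := hfix _ (hK.conj_mem c hc x)
      rw [map_mul, map_mul, map_inv, hfix c hc] at h1
      rw [SetLike.mem_coe, Subgroup.mem_centralizer_singleton_iff]
      have h2 : σ x * c = x * c * x⁻¹ * σ x := by rw [← h1]; group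
      rw [mul_assoc, h2]
      group
    rw [Subgroup.mem_center_iff]
    intro g
    have := this (hEtop ▸ Subgroup.mem_top g)
    rwa [Subgroup.mem_centralizer_singleton_iff] at this
  have hcomm : commutator D ≠ ⊤ := (Group.IsSolvable.commutator_lt_top_of_nontrivial D).ne
  have hcommc : ∀ x y : D, ⁅x, y⁆ ∈ Subgroup.center D := fun x y ↦ by
    refine hcentral (commutator D) inferInstance hcomm (fun k hk ↦ ?_)
      (Subgroup.commutator_mem_commutator (Subgroup.mem_top x) (Subgroup.mem_top y))
    have := (Subgroup.characteristic_iff_le_comap.1 (inferInstance : (commutator D).Characteristic)) σ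
    exact this hk
  let K : Subgroup D := (powMonoidHom r : Abelianization D →* _).range.comap Abelianization.of
  have hKmem : ∀ x, x ^ r ∈ K := fun x ↦ ⟨Abelianization.of x, (map_pow _ _ _).symm⟩
  have hKinv : ∀ k ∈ K, σ k ∈ K := by
    rintro k ⟨y, hy⟩
    refine ⟨Abelianization.map σ.toMonoidHom y, ?_⟩
    have := congrArg (Abelianization.map σ.toMonoidHom) hy
    rw [Abelianization.map_of] at this
    rw [powMonoidHom_apply] at this ⊢
    rw [← map_pow, this]
    rfl
  have hKtop : K ≠ ⊤ := by
    intro h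
    have hsurj : Function.Surjective (powMonoidHom r : Abelianization D →* _) := by
      intro y
      obtain ⟨x, rfl⟩ := QuotientGroup.mk_surjective y
      have : x ∈ K := h ▸ Subgroup.mem_top x
      exact this
    have hinj := Finite.injective_iff_surjective.2 hsurj
    obtain ⟨x, hx⟩ : ∃ x, x ∉ commutator D := by
      by_contra! H
      exact hcomm (eq_top_iff.2 fun x _ ↦ H x)
    have hx1 : Abelianization.of x ≠ 1 := by
      rwa [Ne, ← MonoidHom.mem_ker, Abelianization.ker_of]
    obtain ⟨k, hk⟩ := hD x
    have hpow : ∀ k : ℕ, ∀ y : Abelianization D, y ^ r ^ k = 1 → y = 1 := fun k ↦ by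
      induction k with
      | zero => simp
      | succ k ih =>
        intro y hy
        rw [pow_succ, pow_mul] at hy
        have : powMonoidHom r (y ^ r ^ k) = powMonoidHom r 1 := by simpa using hy
        exact ih y (hinj this)
    exact hx1 (hpow k _ (by rw [← map_pow, hk, map_one]))
  have hKc := hcentral K inferInstance hKtop hKinv
  have hmulpow : ∀ u w : D, (u * w) ^ r = u ^ r * w ^ r := by
    intro u w
    have hwu : w * u = ⁅w, u⁆ * (u * w) := by rw [commutatorElement_def]; group
    have hpow := mul_pow_of_mul_eq_central (hcommc w u) hwu r
    have hone : ⁅w, u⁆ ^ r = 1 := by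
      have h1 := hpow.1
      rw [← Subgroup.mem_center_iff.1 (hKc (hKmem w)) u] at h1
      exact (mul_eq_right.1 h1.symm)
    obtain ⟨m, hm⟩ : r ∣ r.choose 2 := hr.dvd_choose_self two_ne_zero
      (lt_of_le_of_ne hr.two_le hr2.symm)
    rw [hpow.2, hm, pow_mul, hone, one_pow, one_mul]
  refine ⟨fun x ↦ ?_, hcommc⟩
  have hx : x ∈ E := hEtop ▸ Subgroup.mem_top x
  induction hx using Subgroup.closure_induction with
  | mem y hy =>
    obtain ⟨x, rfl⟩ := hy
    dsimp only
    rw [hmulpow, ← map_pow, hmin K hKtop hKinv _ (hKmem x), inv_pow, inv_mul_cancel]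
  | one => exact one_pow r
  | mul x y _ _ hx hy => rw [hmulpow, hx, hy, one_mul]
  | inv x _ hx => rw [inv_pow, hx, inv_one]

end

end

section

open scoped commutatorElement

theorem commute_of_conj_pow_eq_one {D : Type*} [Group D]
    (hcomm : ∀ x y : D, ⁅x, y⁆ ∈ Subgroup.center D)
    (h : ∀ x z : D, Commute x z → (∀ i : ℕ, IsConj (x * z ^ i) x) → z = 1) (x y : D) :
    Commute x y := by
  set z := ⁅x⁻¹, y⁆ with hz
  have hzc : z ∈ Subgroup.center D := hcomm _ _
  have hxz : Commute x z := Subgroup.mem_center_iff.1 hzc x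
  have hconj : ∀ i : ℕ, y ^ i * x * (y ^ i)⁻¹ = x * z ^ i := fun i ↦ by
    induction i with
    | zero => simp
    | succ i ih =>
      have h1 : y * x * y⁻¹ = x * z := by rw [hz, commutatorElement_def]; group
      have h2 : y * z ^ i * y⁻¹ = z ^ i := by
        rw [Subgroup.mem_center_iff.1 (pow_mem hzc i) y, mul_inv_cancel_right]
      calc y ^ (i + 1) * x * (y ^ (i + 1))⁻¹ = y * (y ^ i * x * (y ^ i)⁻¹) * y⁻¹ := by
            rw [pow_succ']; group
        _ = (y * x * y⁻¹) * (y * z ^ i * y⁻¹) := by rw [ih]; group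
        _ = x * z ^ (i + 1) := by rw [h1, h2, mul_assoc, pow_succ']
  have := h x z hxz fun i ↦ (isConj_iff.2 ⟨y ^ i, hconj i⟩).symm
  rw [hz, commutatorElement_eq_one_iff_commute] at this
  exact Commute.inv_left_iff.1 this

theorem card_le_sq_of_rank_le_two {D : Type*} [Group D] [Finite D] {r : ℕ} (hr : r.Prime)
    (hexp : ∀ x : D, x ^ r = 1)
    (h : ∀ a b c : D, b ≠ 1 → (∀ i : ℕ, a ≠ b ^ i) → ¬ ∀ i j : ℕ, c ≠ a ^ i * b ^ j) :
    Nat.card D ≤ r ^ 2 := by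
  by_contra! hlt
  have hr1 := hr.one_lt
  have hltr : r < Nat.card D := lt_of_le_of_lt (by nlinarith) hlt
  have hmod : ∀ (x : D) (i : ℕ), x ^ i = x ^ (i % r) := fun x i ↦ by
    conv_lhs => rw [← Nat.div_add_mod i r, pow_add, pow_mul, hexp, one_pow, one_mul]
  have : Nontrivial D := Finite.one_lt_card_iff_nontrivial.1 (hr1.trans hltr)
  obtain ⟨b, hb⟩ := exists_ne (1 : D)
  obtain ⟨a, ha⟩ : ∃ a, ∀ i : Fin r, b ^ (i : ℕ) ≠ a := by
    by_contra! H
    have := Nat.card_le_card_of_surjective (fun i : Fin r ↦ b ^ (i : ℕ)) H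
    rw [Nat.card_fin] at this
    lia
  obtain ⟨c, hc⟩ : ∃ c, ∀ i : Fin r × Fin r, a ^ (i.1 : ℕ) * b ^ (i.2 : ℕ) ≠ c := by
    by_contra! H
    have := Nat.card_le_card_of_surjective
      (fun i : Fin r × Fin r ↦ a ^ (i.1 : ℕ) * b ^ (i.2 : ℕ)) H
    rw [Nat.card_prod, Nat.card_fin, ← sq] at this
    lia
  refine h a b c hb (fun i hi ↦ ?_) fun i j hij ↦ ?_
  · rw [hmod] at hi
    exact ha ⟨i % r, Nat.mod_lt _ hr.pos⟩ hi.symm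
  · rw [hmod a, hmod b] at hij
    exact hc (⟨i % r, Nat.mod_lt _ hr.pos⟩, ⟨j % r, Nat.mod_lt _ hr.pos⟩) hij.symm

theorem MulAut.eq_one_of_card_le_sq {D : Type*} [Group D] [Finite D] {r s : ℕ} (hr : r.Prime)
    (hr2 : r ≠ 2) (hs : s.Prime) (hrs : r < s) (hD : IsPGroup r D) (hcard : Nat.card D ≤ r ^ 2)
    {σ : MulAut D} {k : ℕ} (hσ : σ ^ s ^ k = 1) : σ = 1 := by
  have : Fact r.Prime := ⟨hr⟩
  have : Fact s.Prime := ⟨hs⟩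
  let F : Subgroup D := MonoidHom.eqLocus σ.toMonoidHom (MonoidHom.id D)
  have hF : ∀ d, d ∈ F ↔ σ d = d := fun d ↦ Iff.rfl
  have hp : IsPGroup s (Subgroup.zpowers σ) := by
    rintro ⟨_, m, rfl⟩
    refine ⟨k, Subtype.ext ?_⟩
    change (σ ^ m) ^ s ^ k = 1
    rw [← zpow_natCast, ← zpow_mul, mul_comm, zpow_mul, zpow_natCast, hσ, one_zpow]
  have hfix : MulAction.fixedPoints (Subgroup.zpowers σ) D = F := by
    ext d
    rw [MulAction.mem_fixedPoints]
    constructor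
    · exact fun h ↦ h ⟨σ, Subgroup.mem_zpowers σ⟩
    · rintro h ⟨τ, hτ⟩
      have : Subgroup.zpowers σ ≤ MulAction.stabilizer (MulAut D) d := by
        rw [Subgroup.zpowers_le]
        exact h
      exact this hτ
  have hmod := hp.card_modEq_card_fixedPoints D
  rw [hfix] at hmod
  obtain ⟨m, hm⟩ := IsPGroup.iff_card.1 hD
  obtain ⟨j, hj⟩ := IsPGroup.iff_card.1 (hD.to_subgroup F)
  have hj' : Nat.card (F : Set D) = r ^ j := hj
  rw [hj', hm] at hmod
  rw [hm] at hcard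
  have hm2 : m ≤ 2 := (Nat.pow_le_pow_iff_right hr.one_lt).1 hcard
  have hjm : j ≤ m := (Nat.pow_le_pow_iff_right hr.one_lt).1 (hm ▸ hj ▸ F.card_le_card_group)
  have hjm' : j = m := by
    by_contra hne
    have hdvd := (Nat.modEq_iff_dvd' (Nat.pow_le_pow_right hr.pos hjm)).1 hmod.symm
    have h3 := lt_of_le_of_ne hr.two_le hr2.symm
    have key1 : ¬ s ∣ r - 1 := fun h ↦ by have := Nat.le_of_dvd (by lia) h; lia
    have key2 : ¬ s ∣ r := fun h ↦ by have := Nat.le_of_dvd (by lia) h; lia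
    have key3 : ¬ s ∣ r + 1 := fun h ↦ by
      have := Nat.le_of_dvd (by lia) h
      have hodd := hr.eq_two_or_odd
      have hodd' := hs.eq_two_or_odd
      lia
    obtain ⟨t, rfl⟩ : ∃ t, r = t + 1 := ⟨r - 1, by lia⟩
    interval_cases m <;> interval_cases j <;> simp at hne hdvd
    · exact key1 (by simpa using hdvd)
    · rw [show (t + 1) ^ 2 - 1 = (t + 1 - 1) * (t + 1 + 1) by simp; ring_nf; lia, hs.dvd_mul] at hdvd
      exact hdvd.elim key1 key3
    · rw [show (t + 1) ^ 2 - (t + 1) = (t + 1 - 1) * (t + 1) by simp; ring_nf; lia, hs.dvd_mul] at hdvd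
      exact hdvd.elim key1 key2
  have hFtop : F = ⊤ := Subgroup.eq_top_of_card_eq F (by rw [hj, hm, hjm'])
  ext d
  exact (hF d).1 (hFtop ▸ Subgroup.mem_top d)

/-- In a group whose `r`-subgroups of exponent `r` are small, for `r` an odd prime, elements of
prime power order for larger primes centralize the `r`-subgroups which they normalize. -/
theorem commute_of_mem_normalizer_isPGroup {L : Type*} [Group L] [Finite L] {r s : ℕ}
    (hr : r.Prime) (hr2 : r ≠ 2) (hs : s.Prime) (hrs : r < s)
    (h1 : ∀ x z : L, Commute x z → x ^ r = 1 → z ^ r = 1 → (∀ i : ℕ, IsConj (x * z ^ i) x) → z = 1)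
    (h2 : ∀ a b c : L, Commute a b → Commute a c → Commute b c → a ^ r = 1 → b ^ r = 1 →
      c ^ r = 1 → b ≠ 1 → (∀ i : ℕ, a ≠ b ^ i) → ¬ ∀ i j : ℕ, c ≠ a ^ i * b ^ j)
    {g : L} {k : ℕ} (hg : g ^ s ^ k = 1) (D : Subgroup L) (hD : IsPGroup r D)
    (hgD : g ∈ Subgroup.normalizer (D : Set L)) : g ∈ Subgroup.centralizer (D : Set L) := by
  induction hn : Nat.card D using Nat.strong_induction_on generalizing D with
  | _ n ih =>
  subst hn
  set σ : MulAut D := D.normalizerMonoidHom ⟨g, hgD⟩ with hσ_def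
  have hσ : ∀ d : D, (σ d : L) = g * d * g⁻¹ := fun d ↦ rfl
  have hcent : σ = 1 → g ∈ Subgroup.centralizer (D : Set L) := by
    rw [Subgroup.mem_centralizer_iff]
    intro h d hd
    have := hσ ⟨d, hd⟩
    rw [h] at this
    exact (eq_mul_inv_iff_mul_eq.1 this)
  by_contra hnot
  have hσ1 : σ ≠ 1 := fun h ↦ hnot (hcent h)
  have hσpow : σ ^ s ^ k = 1 := by
    rw [hσ_def, ← map_pow]
    convert map_one (D.normalizerMonoidHom)
    exact Subtype.ext hg
  have hcop : r.Coprime (s ^ k) := ((Nat.coprime_primes hr hs).2 hrs.ne).pow_right k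
  obtain ⟨hexp, hcomm⟩ := pow_eq_one_and_commutator_mem_center_of_minimal_mulAut hr hr2 hD hσ1 hσpow
    hcop (by
      intro K hK hinv x hx
      have hcard : Nat.card (K.map D.subtype) < Nat.card D := by
        rw [Subgroup.card_map_of_injective D.subtype_injective]
        exact lt_of_le_of_ne K.card_le_card_group fun h ↦ hK (Subgroup.eq_top_of_card_eq K h)
      have hnorm : g ∈ Subgroup.normalizer ((K.map D.subtype : Subgroup L) : Set L) := by
        apply Subgroup.mem_normalizer_fintype
        rintro _ ⟨d, hd, rfl⟩
        exact ⟨σ d, hinv d hd, hσ d⟩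
      have := ih _ hcard (K.map D.subtype) ((hD.to_subgroup K).map _) hnorm rfl
      have := Subgroup.mem_centralizer_iff.1 this x ⟨x, hx, rfl⟩
      apply Subtype.ext
      rw [hσ, ← this, mul_inv_cancel_right])
  have hcoe : ∀ d : D, (d : L) ^ r = 1 := fun d ↦ congrArg Subtype.val (hexp d)
  have habel : ∀ x y : D, Commute x y := commute_of_conj_pow_eq_one hcomm fun x z hxz hconj ↦
    Subtype.ext (h1 x z (hxz.map D.subtype) (hcoe x) (hcoe z) fun i ↦
      D.subtype.map_isConj (hconj i))
  have hcard := card_le_sq_of_rank_le_two hr hexp fun a b c hb ha hc ↦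
    h2 a b c ((habel a b).map D.subtype) ((habel a c).map D.subtype) ((habel b c).map D.subtype)
      (hcoe a) (hcoe b) (hcoe c) (fun h ↦ hb (Subtype.ext h))
      (fun i h ↦ ha i (Subtype.ext h)) (fun i j h ↦ hc i j (Subtype.ext h))
  exact hσ1 (MulAut.eq_one_of_card_le_sq hr hr2 hs hrs hD hcard hσpow)

end

section

open scoped commutatorElement Pointwise

theorem Sylow.sup_eq_top_of_pow_prime_mem {M : Type*} [Group M] [Finite M] {r : ℕ} [Fact r.Prime]
    {K : Subgroup M}
    (hK : ∀ s k : ℕ, s.Prime → s ≠ r → ∀ g : M, g ^ s ^ k = 1 → g ∈ K) (W : Sylow r M) :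
    K ⊔ W = ⊤ := by
  rw [← Subgroup.index_eq_one]
  by_contra hne
  obtain ⟨s, hs, hdvd⟩ := Nat.exists_prime_and_dvd hne
  by_cases hsr : s = r
  · subst hsr
    exact W.not_dvd_index (hdvd.trans (Subgroup.index_dvd_of_le le_sup_right))
  · have : Fact s.Prime := ⟨hs⟩
    obtain ⟨S⟩ : Nonempty (Sylow s M) := inferInstance
    have hSK : (S : Subgroup M) ≤ K := fun x hx ↦ by
      obtain ⟨k, hk⟩ := S.isPGroup' ⟨x, hx⟩
      exact hK s k hs hsr x (congrArg Subtype.val hk)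
    exact S.not_dvd_index (hdvd.trans (Subgroup.index_dvd_of_le (hSK.trans le_sup_left)))

theorem Sylow.exists_mem_smul_eq_of_pow_prime_mem {M : Type*} [Group M] [Finite M] {r : ℕ}
    [Fact r.Prime] {K : Subgroup M} [K.Normal]
    (hK : ∀ s k : ℕ, s.Prime → s ≠ r → ∀ g : M, g ^ s ^ k = 1 → g ∈ K) (U W : Sylow r M) :
    ∃ c ∈ K, c • U = W := by
  obtain ⟨g, hg⟩ := MulAction.exists_smul_eq M U W
  have : g ∈ K ⊔ (U : Subgroup M) := Sylow.sup_eq_top_of_pow_prime_mem hK U ▸ Subgroup.mem_top g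
  obtain ⟨c, hc, u, hu, rfl⟩ := Subgroup.mem_sup_of_normal_left.1 this
  refine ⟨c, hc, ?_⟩
  rw [← hg, mul_smul]
  congr 1
  exact (Sylow.smul_eq_iff_mem_normalizer.2 (Subgroup.le_normalizer hu)).symm

theorem Sylow.lt_normalizer_inf {L : Type*} [Group L] [Finite L] {r : ℕ} [Fact r.Prime]
    (R : Sylow r L) {D : Subgroup L} (hDR : D < R) : D < Subgroup.normalizer (D : Set L) ⊓ R := by
  have : Group.IsNilpotent R := R.isPGroup'.isNilpotent
  have hlt : D.subgroupOf R < ⊤ := by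
    rw [lt_top_iff_ne_top, Ne, Subgroup.subgroupOf_eq_top]
    exact hDR.not_ge
  obtain ⟨-, h⟩ := Group.normalizerCondition_of_isNilpotent _ hlt
  obtain ⟨x, hx, hxD⟩ := Set.not_subset.1 h
  refine lt_of_le_of_ne (le_inf Subgroup.le_normalizer hDR.le) fun heq ↦ hxD ?_
  have hxn : (x : L) ∈ Subgroup.normalizer (D : Set L) := by
    apply Subgroup.mem_normalizer_fintype
    intro d hd
    exact (Subgroup.mem_normalizer_iff.1 hx ⟨d, hDR.le hd⟩).1 hd
  change (x : L) ∈ D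
  rw [heq]
  exact ⟨hxn, x.2⟩

section

variable {L : Type*} [Group L] [Finite L] {r : ℕ} [hr : Fact r.Prime]

theorem Sylow.exists_mem_centralizer_smul_eq
    (hB : ∀ s k : ℕ, s.Prime → s ≠ r → ∀ g : L, g ^ s ^ k = 1 → ∀ D : Subgroup L, IsPGroup r D →
      g ∈ Subgroup.normalizer (D : Set L) → g ∈ Subgroup.centralizer (D : Set L))
    (R₁ R₂ : Sylow r L) (D : Subgroup L) (h₁ : D ≤ R₁) (h₂ : D ≤ R₂) :
    ∃ c ∈ Subgroup.centralizer (D : Set L), c • R₁ = R₂ := by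
  induction hn : Nat.card L - Nat.card D using Nat.strong_induction_on generalizing D R₁ R₂ with
  | _ n ih =>
  subst hn
  by_cases he₁ : D = R₁
  · refine ⟨1, one_mem _, ?_⟩
    rw [one_smul]
    exact Sylow.ext (R₁.is_maximal' R₂.isPGroup' (he₁ ▸ h₂)).symm
  by_cases he₂ : D = R₂
  · refine ⟨1, one_mem _, ?_⟩
    rw [one_smul]
    exact Sylow.ext (R₂.is_maximal' R₁.isPGroup' (he₂ ▸ h₁))
  set M := Subgroup.normalizer (D : Set L) with hM
  have hlt₁ := R₁.lt_normalizer_inf (lt_of_le_of_ne h₁ he₁)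
  have hlt₂ := R₂.lt_normalizer_inf (lt_of_le_of_ne h₂ he₂)
  rw [← hM] at hlt₁ hlt₂
  have hIH : ∀ N : Subgroup L, D < N → ∀ R₁ R₂ : Sylow r L, N ≤ R₁ → N ≤ R₂ →
      ∃ c ∈ Subgroup.centralizer (D : Set L), c • R₁ = R₂ := by
    intro N hDN R₁ R₂ hN₁ hN₂
    have hcard : Nat.card D < Nat.card N := Set.ncard_lt_ncard hDN
    have := N.card_le_card_group
    obtain ⟨c, hc, hcR⟩ := ih _ (by lia) R₁ R₂ N hN₁ hN₂ rfl
    exact ⟨c, Subgroup.centralizer_le hDN.le hc, hcR⟩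
  have hpg : ∀ R : Sylow r L, IsPGroup r ((M ⊓ R).subgroupOf M) := fun R ↦
    (R.isPGroup'.to_le inf_le_right).comap_of_injective _ M.subtype_injective
  obtain ⟨U, hU⟩ := (hpg R₁).exists_le_sylow
  obtain ⟨W, hW⟩ := (hpg R₂).exists_le_sylow
  obtain ⟨c, hc, hcU⟩ := Sylow.exists_mem_smul_eq_of_pow_prime_mem
    (K := (Subgroup.centralizer (D : Set L)).subgroupOf M)
    (fun s k hs hsr g hg ↦ hB s k hs hsr g (congrArg Subtype.val hg) D
      (R₁.isPGroup'.to_le h₁) g.2) U W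
  obtain ⟨R₃, hR₃⟩ := (U.isPGroup'.map M.subtype).exists_le_sylow
  obtain ⟨c₁, hc₁, hcR₁⟩ := hIH _ hlt₁ R₁ R₃ inf_le_right
    fun x hx ↦ hR₃ ⟨⟨x, hx.1⟩, hU hx, rfl⟩
  obtain ⟨c₂, hc₂, hcR₂⟩ := hIH _ hlt₂ ((c : L) • R₃) R₂ (fun x hx ↦ by
    have hxW : (⟨x, hx.1⟩ : M) ∈ c • U := hcU ▸ hW hx
    obtain ⟨u, hu, hux⟩ := hxW
    exact ⟨u, hR₃ ⟨u, hu, rfl⟩, congrArg Subtype.val hux⟩) inf_le_right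
  exact ⟨c₂ * (c * c₁), mul_mem hc₂ (mul_mem hc hc₁), by rw [mul_smul, mul_smul, hcR₁, hcR₂]⟩

theorem Sylow.exists_mem_conj_eq
    (hB : ∀ s k : ℕ, s.Prime → s ≠ r → ∀ g : L, g ^ s ^ k = 1 → ∀ D : Subgroup L, IsPGroup r D →
      g ∈ Subgroup.normalizer (D : Set L) → g ∈ Subgroup.centralizer (D : Set L))
    (R : Sylow r L) {x u : L} (hx : x ∈ R) (hux : u * x * u⁻¹ ∈ R) :
    ∃ t ∈ R, u * x * u⁻¹ = t * x * t⁻¹ := by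
  obtain ⟨c, hc, hcR⟩ := Sylow.exists_mem_centralizer_smul_eq hB (u • R) R
    (Subgroup.zpowers (u * x * u⁻¹)) (by
      rw [Subgroup.zpowers_le]
      exact ⟨x, hx, rfl⟩) (by rwa [Subgroup.zpowers_le])
  rw [Subgroup.mem_centralizer_iff] at hc
  have hcx := hc _ (Subgroup.mem_zpowers _)
  rw [← mul_smul, Sylow.smul_eq_iff_mem_normalizer] at hcR
  set M := Subgroup.normalizer ((R : Subgroup L) : Set L) with hM
  have hRM : (R : Subgroup L) ≤ M := Subgroup.le_normalizer
  have htop := Sylow.sup_eq_top_of_pow_prime_mem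
    (K := (Subgroup.centralizer ((R : Subgroup L) : Set L)).subgroupOf M)
    (fun s k hs hsr g hg ↦ hB s k hs hsr g (congrArg Subtype.val hg) R R.isPGroup' g.2)
    (R.subtype hRM)
  have hmem : (⟨c * u, hcR⟩ : M) ∈ (⊤ : Subgroup M) := Subgroup.mem_top _
  rw [← htop, Subgroup.mem_sup_of_normal_left] at hmem
  obtain ⟨k, hk, t, ht, hkt⟩ := hmem
  have ht' : (t : L) ∈ R := ht
  have hkt' : (k : L) * t = c * u := congrArg Subtype.val hkt
  refine ⟨t, ht', ?_⟩
  have hkx := Subgroup.mem_centralizer_iff.1 hk _ (mul_mem (mul_mem ht' hx) (inv_mem ht'))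
  calc u * x * u⁻¹ = c * (u * x * u⁻¹) * c⁻¹ := by rw [← hcx, mul_inv_cancel_right]
    _ = (c * u) * x * (c * u)⁻¹ := by group
    _ = k * (t * x * (t : L)⁻¹) * (k : L)⁻¹ := by rw [← hkt']; group
    _ = t * x * (t : L)⁻¹ := by
      rw [mul_inv_eq_iff_eq_mul]; exact hkx.symm

theorem commutator_ne_top_of_normalizer_le_centralizer
    (hB : ∀ s k : ℕ, s.Prime → s ≠ r → ∀ g : L, g ^ s ^ k = 1 → ∀ D : Subgroup L, IsPGroup r D →
      g ∈ Subgroup.normalizer (D : Set L) → g ∈ Subgroup.centralizer (D : Set L))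
    (hrL : r ∣ Nat.card L) : commutator L ≠ ⊤ := by
  intro hperf
  obtain ⟨R⟩ : Nonempty (Sylow r L) := inferInstance
  have hfocal := Subgroup.commutator_inf_eq_focalSubgroup R
  rw [hperf, top_inf_eq] at hfocal
  have hle : (R : Subgroup L) ≤ ⁅(R : Subgroup L), (R : Subgroup L)⁆ := by
    conv_lhs => rw [hfocal, Subgroup.focalSubgroup_def]
    rw [Subgroup.closure_le]
    rintro g ⟨hg, x, hx, u, rfl⟩
    rw [commutatorElement_def] at hg
    have hxu : u * x⁻¹ * u⁻¹ ∈ R := by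
      have := mul_mem (inv_mem hx) hg
      rwa [mul_assoc, mul_assoc, inv_mul_cancel_left, ← mul_assoc] at this
    obtain ⟨t, ht, htx⟩ := R.exists_mem_conj_eq hB (inv_mem hx) hxu
    have : ⁅x, u⁆ = ⁅x, t⁆ := by
      rw [commutatorElement_def, commutatorElement_def, mul_assoc, mul_assoc, ← mul_assoc u, htx]
      group
    rw [this]
    exact Subgroup.commutator_mem_commutator hx ht
  have hnil : Group.IsNilpotent R := R.isPGroup'.isNilpotent
  have : Nontrivial R :=
     (Subgroup.nontrivial_iff_ne_bot _).2 (R.ne_bot_of_dvd_card hrL)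
  have hlt := Group.IsSolvable.commutator_lt_top_of_nontrivial R
  refine hlt.ne (eq_top_iff.2 fun x _ ↦ ?_)
  have hx := hle x.2
  rw [← Subgroup.map_subtype_commutator] at hx
  obtain ⟨y, hy, hyx⟩ := hx
  rwa [← Subtype.ext hyx]

end

end

section

open scoped commutatorElement

theorem IsRigidRep.mem_center_of_sq_eq_one {L A : Type*} [Group L] [AddCommGroup A]
    {ρ : L →* AddMonoid.End A} {p : ℕ} (hρ : IsRigidRep p ρ) {z : L} (hz : z ^ 2 = 1)
    (hfree : ¬ HasFixedVector ρ z) : z ∈ Subgroup.center L := by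
  have := hρ.nontrivial
  have hzz : ρ z * ρ z = 1 := by rw [← map_mul, ← sq, hz, map_one]
  have hneg : ρ z = -1 := by
    ext v
    by_contra hv
    refine hfree ⟨v + ρ z v, fun h ↦ hv ?_, ?_⟩
    · exact eq_neg_of_add_eq_zero_right h
    · rw [map_add, add_comm]
      congr 1
      exact DFunLike.congr_fun hzz v
  rw [Subgroup.mem_center_iff]
  intro h
  by_contra hne
  have hc : h * z * h⁻¹ * z ≠ 1 := fun hc ↦ hne (by
    rw [mul_eq_one_iff_eq_inv, inv_eq_of_mul_eq_one_right ((sq z).symm.trans hz)] at hc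
    rwa [mul_inv_eq_iff_eq_mul] at hc)
  refine hfree (.of_map_eq_one (hρ.rigid _ hc ?_ z))
  rw [map_mul, map_mul, map_mul, hneg]
  simp only [mul_neg, mul_one, neg_mul, neg_neg]
  rw [← map_mul, mul_inv_cancel, map_one]

theorem false_of_isRigidRep_of_perfect {L A B : Type*} [Group L] [Finite L] [Nontrivial L]
    [AddCommGroup A] [AddCommGroup B] {p q : ℕ} {ρ : L →* AddMonoid.End A}
    {τ : L →* AddMonoid.End B} (hρ : IsRigidRep p ρ) (hτ : IsRigidRep q τ)
    (hstar : ∀ g : L, HasFixedVector ρ g → HasFixedVector τ g → g = 1)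
    (hperf : commutator L = ⊤) (hcenter : Subgroup.center L = ⊥) : False := by
  set r := (Nat.card L).minFac with hr_def
  have hr : r.Prime := Nat.minFac_prime Finite.one_lt_card.ne'
  have : Fact r.Prime := ⟨hr⟩
  have hrL : r ∣ Nat.card L := Nat.minFac_dvd _
  have hr2 : r ≠ 2 := by
    intro h2
    obtain ⟨z, hz⟩ := exists_prime_orderOf_dvd_card' r hrL
    rw [h2] at hz
    have hz2 : z ^ 2 = 1 := hz ▸ pow_orderOf_eq_one z
    have hz1 : z = 1 := by
      by_contra hne
      have hzc : z ∉ Subgroup.center L := by rwa [hcenter, Subgroup.mem_bot]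
      exact hne (hstar z (not_not.1 fun h ↦ hzc (hρ.mem_center_of_sq_eq_one hz2 h))
        (not_not.1 fun h ↦ hzc (hτ.mem_center_of_sq_eq_one hz2 h)))
    rw [hz1, orderOf_one] at hz
    lia
  refine commutator_ne_top_of_normalizer_le_centralizer (r := r) ?_ hrL hperf
  intro s k hs hsr g hg D hD hgD
  by_cases hsL : s ∣ Nat.card L
  · refine commute_of_mem_normalizer_isPGroup hr hr2 hs
      (lt_of_le_of_ne (Nat.minFac_le_of_dvd hs.two_le hsL) hsr.symm) ?_ ?_ hg D hD hgD
    · intro x z hxz hx hz hconj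
      by_contra hz1
      exact false_of_isConj_mul_pow hρ hτ hstar hr hxz hx hz hz1 hconj
    · intro a b c hab hac hbc ha hb hc hb1 hab' habc
      exact false_of_rank_three hρ hτ hstar hr hab hac hbc ha hb hc hb1 hab' habc
  · have hcop : (s ^ k).Coprime (Nat.card L) := ((hs.coprime_iff_not_dvd.2 hsL)).pow_left k
    rw [orderOf_eq_one_iff.1 (Nat.eq_one_of_dvd_coprimes hcop (orderOf_dvd_of_pow_eq_one hg)
      (orderOf_dvd_natCard g))]
    exact one_mem _

theorem Subgroup.eq_bot_of_commute_of_normal {H : Type*} [Group H] [Finite H]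
    (hnormal : ∀ s : ℕ, s.Prime → ∀ N : Subgroup H, N.Normal → IsPGroup s N → N = ⊥)
    (K : Subgroup H) (hK : K.Normal) (hcomm : ∀ x ∈ K, ∀ y ∈ K, Commute x y) : K = ⊥ := by
  by_contra hne
  have hcard : Nat.card K ≠ 1 := fun h ↦ hne (K.eq_bot_of_card_eq h)
  obtain ⟨s, hs, hsK⟩ := Nat.exists_prime_and_dvd hcard
  have : Fact s.Prime := ⟨hs⟩
  obtain ⟨z, hz⟩ := exists_prime_orderOf_dvd_card' s hsK
  let M : Subgroup H :=
    { carrier := {x | x ∈ K ∧ x ^ s = 1}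
      mul_mem' := fun {x y} hx hy ↦ ⟨mul_mem hx.1 hy.1, by
        rw [(hcomm x hx.1 y hy.1).mul_pow, hx.2, hy.2, one_mul]⟩
      one_mem' := ⟨one_mem _, one_pow s⟩
      inv_mem' := fun {x} hx ↦ ⟨inv_mem hx.1, by rw [inv_pow, hx.2, inv_one]⟩ }
  have hM : M.Normal := ⟨fun x hx g ↦ ⟨hK.conj_mem x hx.1 g, by rw [conj_pow, hx.2]; group⟩⟩
  have hMbot : M = ⊥ := hnormal s hs M hM fun x ↦ ⟨1, Subtype.ext (by simpa using x.2.2)⟩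
  have hzM : (z : H) ∈ M :=
    ⟨z.2, congrArg Subtype.val (orderOf_dvd_iff_pow_eq_one.1 hz.dvd)⟩
  rw [hMbot, Subgroup.mem_bot] at hzM
  rw [← Subgroup.orderOf_coe, hzM, orderOf_one] at hz
  exact hs.one_lt.ne hz

theorem IsRigidRep.restrict {H V : Type*} [Group H] [AddCommGroup V] [Nontrivial V] {p : ℕ}
    (hp : p.Prime) (hV : ∀ v : V, p • v = 0) (ρ : H →* AddMonoid.End V) {N : Subgroup H} [N.Normal]
    (hmin : ∀ K : Subgroup H, K.Normal → K ≤ N → K ≠ ⊥ → K = N) :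
    IsRigidRep p (ρ.comp N.subtype) where
  prime := hp
  nontrivial := inferInstance
  nsmul_eq_zero := hV
  rigid g hg hρg h := by
    have hN := hmin (N ⊓ ρ.ker) inferInstance inf_le_left fun hbot ↦ by
      have : (g : H) ∈ N ⊓ ρ.ker := ⟨g.2, hρg⟩
      rw [hbot, Subgroup.mem_bot] at this
      exact hg (Subtype.ext this)
    have hh : (h : H) ∈ N ⊓ ρ.ker := hN.symm ▸ h.2
    exact hh.2

theorem false_of_two_reps {H A B : Type*} [Group H] [Finite H] [Nontrivial H]
    [AddCommGroup A] [AddCommGroup B] [Nontrivial A] [Nontrivial B] {p q : ℕ} (hp : p.Prime)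
    (hq : q.Prime) (hA : ∀ a : A, p • a = 0) (hB : ∀ b : B, q • b = 0)
    (ρ : H →* AddMonoid.End A) (τ : H →* AddMonoid.End B)
    (hstar : ∀ g : H, HasFixedVector ρ g → HasFixedVector τ g → g = 1)
    (hnormal : ∀ s : ℕ, s.Prime → ∀ N : Subgroup H, N.Normal → IsPGroup s N → N = ⊥) :
    False := by
  obtain ⟨N, ⟨hN, hNbot⟩, hNmin⟩ := (Set.toFinite {N : Subgroup H | N.Normal ∧ N ≠ ⊥}).exists_minimal
    ⟨⊤, inferInstance, top_ne_bot⟩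
  have hmin : ∀ K : Subgroup H, K.Normal → K ≤ N → K ≠ ⊥ → K = N := fun K hK hKN hKbot ↦
    le_antisymm hKN (hNmin ⟨hK, hKbot⟩ hKN)
  have : Nontrivial N := (Subgroup.nontrivial_iff_ne_bot N).2 hNbot
  have hcomm : ⁅N, N⁆ = N := by
    refine hmin _ inferInstance (Subgroup.commutator_le_left N N) fun hbot ↦ hNbot ?_
    refine Subgroup.eq_bot_of_commute_of_normal hnormal N hN fun x hx y hy ↦ ?_
    rw [← commutatorElement_eq_one_iff_commute, ← Subgroup.mem_bot, ← hbot]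
    exact Subgroup.commutator_mem_commutator hx hy
  refine false_of_isRigidRep_of_perfect (L := N) (ρ := ρ.comp N.subtype) (τ := τ.comp N.subtype)
    (.restrict hp hA ρ hmin) (.restrict hq hB τ hmin)
    (fun g hρ hτ ↦ Subtype.ext (hstar g hρ hτ)) ?_ ?_
  · rw [← Subgroup.map_subtype_commutator] at hcomm
    rw [eq_top_iff]
    intro x _
    have hx : (x : H) ∈ (commutator N).map N.subtype := by
      rw [hcomm]
      exact x.2
    obtain ⟨y, hy, hyx⟩ := hx
    exact (Subtype.ext hyx : y = x) ▸ hy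
  · have h := Subgroup.eq_bot_of_commute_of_normal hnormal ((Subgroup.center N).map N.subtype)
      inferInstance (by
        rintro _ ⟨x, hx, rfl⟩ _ ⟨y, -, rfl⟩
        exact (Commute.map (Subgroup.mem_center_iff.1 hx y) N.subtype).symm)
    rwa [Subgroup.map_eq_bot_iff_of_injective _ N.subtype_injective] at h

end

section

open scoped IsMulCommutative

theorem Group.IsNilpotent.exists_mem_center_pow_prime_eq_one {F : Type*} [Group F] [Finite F]
    (hF : Group.IsNilpotent F) {p : ℕ} (hp : p.Prime) (hpF : p ∣ Nat.card F) :
    ∃ u ∈ Subgroup.center F, u ≠ 1 ∧ u ^ p = 1 := by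
  have : Fact p.Prime := ⟨hp⟩
  have hnormal := ((Group.isNilpotent_of_finite_tfae (G := F)).out 0 3).1 hF
  obtain ⟨S⟩ : Nonempty (Sylow p F) := inferInstance
  have : Nontrivial S := (Subgroup.nontrivial_iff_ne_bot _).2 (S.ne_bot_of_dvd_card hpF)
  have := S.isPGroup'.center_nontrivial
  obtain ⟨k, hk⟩ := IsPGroup.iff_card.1 (S.isPGroup'.to_subgroup (Subgroup.center S))
  have hk0 : k ≠ 0 := by
    rintro rfl
    exact Finite.one_lt_card.ne' hk
  obtain ⟨u, hu⟩ := exists_prime_orderOf_dvd_card' (G := Subgroup.center S) p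
    (hk ▸ dvd_pow_self p hk0)
  have hord : orderOf ((u : S) : F) = p := by rw [Subgroup.orderOf_coe, Subgroup.orderOf_coe, hu]
  have htop := Sylow.sup_eq_top_of_pow_prime_mem (K := Subgroup.centralizer {((u : S) : F)}) (by
    intro s k hs hsp g hg
    have : Fact s.Prime := ⟨hs⟩
    have hgp : IsPGroup s (Subgroup.zpowers g) := by
      rw [IsPGroup.iff_card, Nat.card_zpowers]
      obtain ⟨j, -, hj⟩ := (Nat.dvd_prime_pow hs).1 (orderOf_dvd_of_pow_eq_one hg)
      exact ⟨j, hj⟩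
    obtain ⟨T, hT⟩ := hgp.exists_le_sylow
    rw [Subgroup.mem_centralizer_singleton_iff]
    exact Subgroup.commute_of_normal_of_disjoint _ _ (hnormal s ⟨hs⟩ T) (hnormal p ⟨hp⟩ S)
      (IsPGroup.disjoint_of_ne s p hsp _ _ T.isPGroup' S.isPGroup') _ _
      (hT (Subgroup.mem_zpowers g)) (u : S).2) S
  have hle : (S : Subgroup F) ≤ Subgroup.centralizer {((u : S) : F)} := fun g hg ↦ by
    rw [Subgroup.mem_centralizer_singleton_iff]
    exact congrArg Subtype.val (Subgroup.mem_center_iff.1 u.2 ⟨g, hg⟩)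
  rw [sup_eq_left.2 hle] at htop
  refine ⟨(u : S), ?_, ?_, ?_⟩
  · rw [Subgroup.mem_center_iff]
    intro g
    rw [← Subgroup.mem_centralizer_singleton_iff, htop]
    exact Subgroup.mem_top g
  · intro h
    rw [h, orderOf_one] at hord
    exact hp.one_lt.ne hord
  · exact orderOf_dvd_iff_pow_eq_one.1 hord.dvd

section

variable {G : Type*} [Group G]

/-- The conjugation action of `G ⧸ F` on an abelian normal subgroup centralized by `F`. -/
noncomputable def conjRep (F P : Subgroup G) [F.Normal] [P.Normal] [IsMulCommutative P]
    (hFP : F ≤ Subgroup.centralizer (P : Set G)) : G ⧸ F →* AddMonoid.End (Additive P) :=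
  QuotientGroup.lift F ((monoidEndToAdditive P : _ →* _).comp
    ((MulDistribMulAction.toMonoidEnd (MulAut P) P).comp MulAut.conjNormal)) fun f hf ↦ by
      ext x
      have := Subgroup.mem_centralizer_iff.1 (hFP hf) x.toMul x.toMul.2
      change f * (x.toMul : G) * f⁻¹ = x.toMul
      rw [← this, mul_inv_cancel_right]

theorem hasFixedVector_conjRep_iff (F P : Subgroup G) [F.Normal] [P.Normal] [IsMulCommutative P]
    (hFP : F ≤ Subgroup.centralizer (P : Set G)) (z : G) :
    HasFixedVector (A := Additive P) (conjRep F P hFP) (z : G ⧸ F) ↔ ∃ u ∈ P, u ≠ 1 ∧ Commute z u := by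
  have hfix : ∀ u : P, conjRep F P hFP (z : G ⧸ F) (Additive.ofMul u) = Additive.ofMul u ↔
      Commute z u := fun u ↦ by
    have : Commute z u ↔ z * u * z⁻¹ = u := by
      rw [mul_inv_eq_iff_eq_mul]
      rfl
    rw [this]
    exact Subtype.ext_iff
  constructor
  · rintro ⟨u, hu, hzu⟩
    exact ⟨u.toMul, u.toMul.2, fun h ↦ hu (Subtype.ext h), (hfix u.toMul).1 hzu⟩
  · rintro ⟨u, huP, hu, hzu⟩
    exact ⟨Additive.ofMul ⟨u, huP⟩, fun h ↦ hu (congrArg (fun x ↦ ((Additive.toMul x : P) : G)) h),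
      (hfix ⟨u, huP⟩).2 hzu⟩

/-- The elements of order dividing `p` in the center of `F`. -/
def centralTorsion (F : Subgroup G) (p : ℕ) : Subgroup G where
  carrier := {x | x ∈ F ∧ (∀ f ∈ F, Commute x f) ∧ x ^ p = 1}
  mul_mem' {x y} hx hy := ⟨mul_mem hx.1 hy.1, fun f hf ↦ (hx.2.1 f hf).mul_left (hy.2.1 f hf), by
    rw [(hx.2.1 y hy.1).mul_pow, hx.2.2, hy.2.2, one_mul]⟩
  one_mem' := ⟨one_mem _, fun f _ ↦ Commute.one_left f, one_pow p⟩
  inv_mem' {x} hx := ⟨inv_mem hx.1, fun f hf ↦ (hx.2.1 f hf).inv_left, by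
    rw [inv_pow, hx.2.2, inv_one]⟩

instance (F : Subgroup G) [hF : F.Normal] (p : ℕ) : (centralTorsion F p).Normal :=
  ⟨fun x hx g ↦ ⟨hF.conj_mem x hx.1 g, fun f hf ↦ by
    have := (Commute.conj_iff g).2 (hx.2.1 _ (hF.conj_mem f hf g⁻¹))
    simpa [mul_assoc] using this, by
    rw [conj_pow, hx.2.2, mul_one, mul_inv_cancel]⟩⟩

instance (F : Subgroup G) (p : ℕ) : IsMulCommutative (centralTorsion F p) :=
  ⟨⟨fun x y ↦ Subtype.ext (x.2.2.1 y y.2.1)⟩⟩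

theorem le_centralizer_centralTorsion (F : Subgroup G) (p : ℕ) :
    F ≤ Subgroup.centralizer (centralTorsion F p : Set G) := fun f hf ↦ by
  rw [Subgroup.mem_centralizer_iff]
  exact fun x hx ↦ hx.2.1 f hf

theorem nontrivial_centralTorsion {F : Subgroup G} [Finite F] (hF : Group.IsNilpotent F) {p : ℕ}
    (hp : p.Prime) (hpF : p ∣ Nat.card F) : Nontrivial (centralTorsion F p) := by
  obtain ⟨u, hu, hu1, hup⟩ := hF.exists_mem_center_pow_prime_eq_one hp hpF
  refine ⟨⟨⟨u, u.2, fun f hf ↦ ?_, congrArg Subtype.val hup⟩, 1, fun h ↦ hu1 ?_⟩⟩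
  · exact (congrArg Subtype.val (Subgroup.mem_center_iff.1 hu ⟨f, hf⟩)).symm
  · exact Subtype.ext (congrArg (Subtype.val : centralTorsion F p → G) h)

theorem exists_orderOf_dvd_of_commute [Finite G] {F : Subgroup G} {p : ℕ} (hp : p.Prime) {z u : G}
    (hz : z ∉ F) (hu : u ∈ F) (hu1 : u ≠ 1) (hup : u ^ p = 1) (hzu : Commute z u) :
    ∃ w ∉ F, p ∣ orderOf w ∧ orderOf z ∣ orderOf w ∧ ∀ v, Commute z v → Commute u v →
      Commute w v := by
  have : Fact p.Prime := ⟨hp⟩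
  by_cases h : p ∣ orderOf z
  · exact ⟨z, hz, h, dvd_rfl, fun v hv _ ↦ hv⟩
  have hou : orderOf u = p := orderOf_eq_prime hup hu1
  have ho : orderOf (z * u) = orderOf z * p := by
    rw [hzu.orderOf_mul_eq_mul_orderOf_of_coprime, hou]
    rw [hou]
    exact (hp.coprime_iff_not_dvd.2 h).symm
  exact ⟨z * u, fun hmem ↦ hz ((Subgroup.mul_mem_cancel_right F hu).1 hmem),
    ho ▸ dvd_mul_left _ _, ho ▸ dvd_mul_right _ _, fun v hz hu ↦ hz.mul_left hu⟩

theorem exists_commute_of_mem_normal_isPGroup {s p : ℕ} (hs : s.Prime) (hp : p.Prime)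
    {J P : Subgroup G} [J.Normal] [P.Normal] [IsMulCommutative P] [Nontrivial P]
    (hJ : IsPGroup s J) (hP : ∀ x ∈ P, x ^ p = 1) {z : G} (hz : z ∈ J) :
    ∃ u ∈ P, u ≠ 1 ∧ Commute z u := by
  have : Fact s.Prime := ⟨hs⟩
  have : Fact p.Prime := ⟨hp⟩
  by_cases hsp : s = p
  · subst hsp
    obtain ⟨k, hk⟩ := hJ ⟨z, hz⟩
    have hk' : z ^ s ^ k = 1 := congrArg Subtype.val hk
    rw [← hasFixedVector_conjRep_iff ⊥ P bot_le]
    refine AddMonoid.End.exists_fixed_of_pow_prime_pow (A := Additive P) hs (k := k)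
      (fun a ↦ Subtype.ext (hP _ a.toMul.2)) ?_
    rw [← map_pow, ← QuotientGroup.mk_pow, hk', QuotientGroup.mk_one, map_one]
  · obtain ⟨u, hu⟩ := exists_ne (1 : P)
    exact ⟨u, u.2, fun h ↦ hu (Subtype.ext h), Subgroup.commute_of_normal_of_disjoint _ _
      inferInstance inferInstance (IsPGroup.disjoint_of_ne s p hsp J P hJ
        fun x ↦ ⟨1, Subtype.ext (by simpa using hP x x.2)⟩) _ _ hz u.2⟩

/-- A nontrivial normal `s`-subgroup of `G ⧸ frattini G` is covered by a normal `s`-subgroup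
of `G`. -/
theorem exists_normal_isPGroup_not_le_frattini [Finite G] {s : ℕ} (hs : s.Prime)
    {N : Subgroup (G ⧸ frattini G)} (hN : N.Normal) (hNs : IsPGroup s N) (hNbot : N ≠ ⊥) :
    ∃ J : Subgroup G, J.Normal ∧ IsPGroup s J ∧ ¬ J ≤ frattini G := by
  have : Fact s.Prime := ⟨hs⟩
  set K := N.comap (QuotientGroup.mk' (frattini G)) with hK
  obtain ⟨J⟩ : Nonempty (Sylow s K) := inferInstance
  have hFJ : (frattini G).subgroupOf K ⊔ J = ⊤ := by
    refine Sylow.sup_eq_top_of_pow_prime_mem (fun t k ht hts g hg ↦ ?_) J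
    obtain ⟨j, hj⟩ := hNs ⟨_, g.2⟩
    have h1 : (QuotientGroup.mk' (frattini G) g) ^ s ^ j = 1 := congrArg Subtype.val hj
    have h2 : (QuotientGroup.mk' (frattini G) g) ^ t ^ k = 1 := by
      rw [← map_pow, ← Subgroup.coe_pow, hg, Subgroup.coe_one, map_one]
    have h3 := Nat.eq_one_of_dvd_coprimes (((Nat.coprime_primes hs ht).2 (Ne.symm hts)).pow j k)
      (orderOf_dvd_of_pow_eq_one h1) (orderOf_dvd_of_pow_eq_one h2)
    rw [orderOf_eq_one_iff] at h3
    exact (QuotientGroup.eq_one_iff (g : G)).1 h3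
  set J' := (J : Subgroup K).map K.subtype with hJ'
  have hKle : K ≤ frattini G ⊔ J' := by
    have := congrArg (Subgroup.map K.subtype) hFJ
    rw [Subgroup.map_sup, ← MonoidHom.range_eq_map, Subgroup.range_subtype] at this
    rw [← this]
    exact sup_le_sup_right (Subgroup.map_comap_le _ _) _
  refine ⟨J', ?_, J.isPGroup'.map _, fun hle ↦ hNbot ?_⟩
  · rw [← Subgroup.normalizer_eq_top_iff]
    apply frattini_nongenerating
    rw [eq_top_iff, ← J.normalizer_sup_eq_top]
    exact sup_le le_sup_left (hKle.trans (sup_le le_sup_right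
      (Subgroup.le_normalizer.trans le_sup_left)))
  · rw [eq_bot_iff]
    intro n hn
    obtain ⟨x, rfl⟩ := QuotientGroup.mk_surjective n
    have hx : x ∈ frattini G := (hKle.trans (sup_le le_rfl hle)) hn
    exact Subgroup.mem_bot.2 ((QuotientGroup.eq_one_iff x).2 hx)

end

theorem frattini_ne_top_of_nontrivial (G : Type*) [Group G] [Finite G] [Nontrivial G] :
    frattini G ≠ ⊤ := fun h ↦
  bot_ne_top (frattini_nongenerating (K := (⊥ : Subgroup G)) (by rw [h, sup_top_eq]))

theorem exists_notMem_frattini_mul_dvd_orderOf (G : Type*) [Group G] [Finite G] {p q : ℕ}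
    (hp : p.Prime) (hq : q.Prime) (hpq : p ≠ q) (hpF : p ∣ Nat.card (frattini G))
    (hqF : q ∣ Nat.card (frattini G)) : ∃ g : G, g ∉ frattini G ∧ p * q ∣ orderOf g := by
  have hnil := frattini_nilpotent (G := G)
  set F := frattini G with hF
  by_contra! hno
  have := nontrivial_centralTorsion hnil hp hpF
  have := nontrivial_centralTorsion hnil hq hqF
  have : Nontrivial G := (centralTorsion F p).subtype_injective.nontrivial
  have : Nontrivial (G ⧸ F) := by
    rw [QuotientGroup.nontrivial_iff]
    exact frattini_ne_top_of_nontrivial G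
  have hfree : ∀ z : G, (∃ u ∈ centralTorsion F p, u ≠ 1 ∧ Commute z u) →
      (∃ v ∈ centralTorsion F q, v ≠ 1 ∧ Commute z v) → z ∈ F := by
    rintro z ⟨u, hu, hu1, hzu⟩ ⟨v, hv, hv1, hzv⟩
    by_contra hz
    obtain ⟨w, hw, hpw, -, hcomm⟩ := exists_orderOf_dvd_of_commute hp hz hu.1 hu1 hu.2.2 hzu
    obtain ⟨x, hx, hqx, hwx, -⟩ := exists_orderOf_dvd_of_commute hq hw hv.1 hv1 hv.2.2
      (hcomm v hzv (hu.2.1 v hv.1))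
    exact hno x hx (((Nat.coprime_primes hp hq).2 hpq).mul_dvd_of_dvd_of_dvd (hpw.trans hwx) hqx)
  refine false_of_two_reps (H := G ⧸ F) (A := Additive (centralTorsion F p))
    (B := Additive (centralTorsion F q)) hp hq
    (fun a ↦ Subtype.ext a.toMul.2.2.2) (fun a ↦ Subtype.ext a.toMul.2.2.2)
    (conjRep F (centralTorsion F p) (le_centralizer_centralTorsion F p))
    (conjRep F (centralTorsion F q) (le_centralizer_centralTorsion F q)) ?_ ?_
  · intro g hg₁ hg₂
    obtain ⟨z, rfl⟩ := QuotientGroup.mk_surjective g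
    rw [QuotientGroup.eq_one_iff]
    exact hfree z ((hasFixedVector_conjRep_iff _ _ _ z).1 hg₁)
      ((hasFixedVector_conjRep_iff _ _ _ z).1 hg₂)
  · intro s hs N hN hNs
    by_contra hNbot
    obtain ⟨J, hJ, hJs, hJF⟩ := exists_normal_isPGroup_not_le_frattini hs hN hNs hNbot
    exact hJF fun z hz ↦ hfree z
      (exists_commute_of_mem_normal_isPGroup (P := centralTorsion F p) hs hp hJs
        (fun x hx ↦ hx.2.2) hz)
      (exists_commute_of_mem_normal_isPGroup (P := centralTorsion F q) hs hq hJs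
        (fun x hx ↦ hx.2.2) hz)

end

/-- For a finite group `G` and distinct primes `p, q` dividing `|G|`, `p·q` divides the
order of some element of `G` iff `p·q` divides the order of some element of `G` lying
outside the Frattini subgroup of `G` (i.e. the prime graph and the non-Frattini prime
graph of `G` coincide). -/
theorem prime_graph_eq_nonFrattini_prime_graph
    (G : Type*) [Group G] [Finite G] (p q : ℕ) (hp : p.Prime) (hq : q.Prime)
    (hpq : p ≠ q) (hpG : p ∣ Nat.card G) (hqG : q ∣ Nat.card G) :
    (∃ g : G, p * q ∣ orderOf g) ↔ ∃ g : G, g ∉ frattini G ∧ p * q ∣ orderOf g := by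
  refine ⟨fun ⟨g, hg⟩ ↦ ?_, fun ⟨g, _, hg⟩ ↦ ⟨g, hg⟩⟩
  by_cases hgF : g ∈ frattini G
  · have hcard : orderOf g ∣ Nat.card (frattini G) := Subgroup.orderOf_dvd_natCard _ hgF
    exact exists_notMem_frattini_mul_dvd_orderOf G hp hq hpq
      ((dvd_mul_right p q).trans (hg.trans hcard)) ((dvd_mul_left q p).trans (hg.trans hcard))
  · exact ⟨g, hgF, hg⟩
end

section
/- Let G be a finite group and let q be an odd prime. If G contains an element whose order is divisible by 2·q, then there exists an element γ ∈ G \ Frat(G) whose order is of the form 2^a · q^b with a ≥ 1 and b ≥ 1 (i.e., the only primes dividing the order of γ are 2 and q). -/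
namespace Subgroup

open MulAction
open scoped Pointwise commutatorElement

variable {G : Type*} [Group G]

/-- If all elements of order `p ^ a * r ^ b` with `a, b ≥ 1` lie in the Frattini subgroup, so does
every `p`-element commuting with a nontrivial `r`-element. -/
theorem mem_frattini_of_commute {p r : ℕ} (hp : p.Prime) (hr : r.Prime) (hpr : p ≠ r)
    (h : ∀ (γ : G) (a b : ℕ), 1 ≤ a → 1 ≤ b → orderOf γ = p ^ a * r ^ b → γ ∈ frattini G)
    {x z : G} {k l : ℕ} (hx : x ^ p ^ k = 1) (hz : z ^ r ^ l = 1) (hz1 : z ≠ 1)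
    (hxz : Commute x z) : x ∈ frattini G := by
  obtain ⟨a, -, ha⟩ := (Nat.dvd_prime_pow hp).mp (orderOf_dvd_of_pow_eq_one hx)
  obtain ⟨b, -, hb⟩ := (Nat.dvd_prime_pow hr).mp (orderOf_dvd_of_pow_eq_one hz)
  rcases Nat.eq_zero_or_pos a with rfl | ha0
  · rw [pow_zero, orderOf_eq_one_iff] at ha
    exact ha ▸ one_mem _
  have hb0 : 1 ≤ b := by
    rcases Nat.eq_zero_or_pos b with rfl | hb0
    · exact absurd (orderOf_eq_one_iff.mp (by simpa using hb)) hz1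
    · exact hb0
  have hcop : (p ^ a).Coprime (r ^ b) := Nat.coprime_pow_primes a b hp hr hpr
  have hmem := h (x * z) a b ha0 hb0 (by
    rw [hxz.orderOf_mul_eq_mul_orderOf_of_coprime (by rwa [ha, hb]), ha, hb])
  have hpow : (x * z) ^ r ^ b = x ^ r ^ b := by
    rw [hxz.mul_pow, ← hb, pow_orderOf_eq_one, mul_one]
  obtain ⟨m, hm⟩ := exists_pow_eq_self_of_coprime (x := x) (n := r ^ b)
    (by rw [ha]; exact hcop.symm)
  rw [← hm, ← hpow]
  exact pow_mem (pow_mem hmem _) _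

/-- The elements that centralize or invert a normal subgroup form a normal subgroup. -/
theorem exists_normal_mem_iff_centralizes_or_inverts (R : Subgroup G) [R.Normal] :
    ∃ W : Subgroup G, W.Normal ∧
      ∀ x, x ∈ W ↔ x ∈ centralizer R ∨ ∀ y ∈ R, x * y * x⁻¹ = y⁻¹ := by
  have hc {x : G} : x ∈ centralizer R ↔ ∀ y ∈ R, x * y * x⁻¹ = y := by
    rw [mem_centralizer_iff]
    exact forall₂_congr fun y _ => by rw [mul_inv_eq_iff_eq_mul, eq_comm]
  have hmul (x x' y : G) : x * x' * y * (x * x')⁻¹ = x * (x' * y * x'⁻¹) * x⁻¹ := by group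
  refine ⟨{ carrier := {x | x ∈ centralizer R ∨ ∀ y ∈ R, x * y * x⁻¹ = y⁻¹}
            one_mem' := Or.inl (one_mem _)
            mul_mem' := ?_
            inv_mem' := ?_ }, ⟨?_⟩, fun x => Iff.rfl⟩
  · rintro x x' (hx | hx) (hx' | hx')
    · exact Or.inl (mul_mem hx hx')
    · exact Or.inr fun y hy => by rw [hmul, hx' y hy, hc.mp hx _ (inv_mem hy)]
    · exact Or.inr fun y hy => by rw [hmul, hc.mp hx' y hy, hx y hy]
    · exact Or.inl (hc.mpr fun y hy => by rw [hmul, hx' y hy, hx _ (inv_mem hy), inv_inv])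
  · rintro x (hx | hx)
    · exact Or.inl (inv_mem hx)
    · refine Or.inr fun y hy => ?_
      have h := hx _ (‹R.Normal›.conj_mem y hy x⁻¹)
      rw [← inv_inj, ← h]
      group
  · rintro x (hx | hx) g
    · exact Or.inl ((inferInstance : (centralizer (R : Set G)).Normal).conj_mem x hx g)
    · refine Or.inr fun y hy => ?_
      have h := hx _ (‹R.Normal›.conj_mem y hy g⁻¹)
      calc g * x * g⁻¹ * y * (g * x * g⁻¹)⁻¹ = g * (x * (g⁻¹ * y * g⁻¹⁻¹) * x⁻¹) * g⁻¹ := by group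
        _ = y⁻¹ := by rw [h]; group

section Finite

variable [Finite G]

/-- A complement of an abelian normal Hall subgroup is the stabilizer of a class of transversals. -/
theorem IsComplement'.eq_stabilizer_quotientDiff {A H : Subgroup G} [A.Normal]
    [IsMulCommutative A] (hA : Nat.Coprime (Nat.card A) A.index) (h : IsComplement' A H) :
    ∃ α : A.QuotientDiff, stabilizer G α = H := by
  let T : A.LeftTransversal := ⟨H, h.symm⟩
  let α : A.QuotientDiff := Quotient.mk'' T
  have hle : H ≤ stabilizer G α := by
    intro x hx
    refine congrArg Quotient.mk'' (Subtype.ext ?_ : MulOpposite.op x⁻¹ • T = T)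
    change MulOpposite.op x⁻¹ • (H : Set G) = H
    exact rightCoset_mem_rightCoset H (inv_mem hx)
  refine ⟨α, (eq_of_le_of_card_ge hle ?_).symm⟩
  have h₁ := (isComplement'_stabilizer_of_coprime (α := α) hA).card_mul_card
  rw [← h.card_mul_card] at h₁
  exact (Nat.eq_of_mul_eq_mul_left Nat.card_pos h₁).le

/-- Complements of an abelian normal Hall subgroup are conjugate. -/
theorem IsComplement'.exists_map_conj_eq {A H K : Subgroup G} [A.Normal]
    [IsMulCommutative A] (hA : Nat.Coprime (Nat.card A) A.index)
    (hH : IsComplement' A H) (hK : IsComplement' A K) :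
    ∃ a ∈ A, H.map (MulAut.conj a).toMonoidHom = K := by
  obtain ⟨α, rfl⟩ := hH.eq_stabilizer_quotientDiff hA
  obtain ⟨β, rfl⟩ := hK.eq_stabilizer_quotientDiff hA
  obtain ⟨a, rfl⟩ := exists_smul_eq hA α β
  exact ⟨a, a.2, (stabilizer_smul_eq_stabilizer_map_conj (a : G) α).symm⟩

/-- An abelian normal subgroup inside the Frattini subgroup is centralized by every normal
subgroup in which it is a Hall subgroup. -/
theorem le_centralizer_of_le_frattini {A W : Subgroup G} [A.Normal] [W.Normal]
    [IsMulCommutative A] (hAW : A ≤ W) (hAF : A ≤ frattini G)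
    (hcop : Nat.Coprime (Nat.card A) (A.relIndex W)) : W ≤ centralizer A := by
  have hcard : Nat.card (A.subgroupOf W) = Nat.card A :=
    Nat.card_congr (subgroupOfEquivOfLe hAW).toEquiv
  have hcop' : Nat.Coprime (Nat.card (A.subgroupOf W)) (A.subgroupOf W).index := by
    rwa [hcard]
  obtain ⟨H, hH⟩ := exists_right_complement'_of_coprime hcop'
  have hHcop : Nat.Coprime (Nat.card (A.subgroupOf W)) (Nat.card H) := by
    rwa [← hH.symm.index_eq_card]
  have hnorm : normalizer ((H.map W.subtype : Subgroup G) : Set G) ⊔ frattini G = ⊤ := by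
    rw [eq_top_iff]
    intro g _
    have hHg : IsComplement' (A.subgroupOf W)
        (H.map (MulAut.conjNormal g : MulAut W).toMonoidHom) := by
      have hc : Nat.card (H.map (MulAut.conjNormal g : MulAut W).toMonoidHom) = Nat.card H :=
        card_map_of_injective (MulAut.conjNormal g : MulAut W).injective
      apply isComplement'_of_coprime
      · rw [hc, hH.card_mul_card]
      · rwa [hc]
    obtain ⟨a, ha, hag⟩ := hH.exists_map_conj_eq hcop' hHg
    have hn : (a : G)⁻¹ * g ∈ normalizer ((H.map W.subtype : Subgroup G) : Set G) := by
      have hconj : (H.map W.subtype).map (MulAut.conj g).toMonoidHom =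
          (H.map W.subtype).map (MulAut.conj (a : G)).toMonoidHom := by
        have := congrArg (map W.subtype) hag
        rw [map_map, map_map] at this
        rw [map_map, map_map]
        exact this.symm
      rw [mem_normalizer_iff_map_conj_eq]
      have hcomp : ((MulAut.conj ((a : G)⁻¹ * g)).toMonoidHom : G →* G) =
          (MulAut.conj (a : G)⁻¹).toMonoidHom.comp (MulAut.conj g).toMonoidHom := by
        rw [map_mul]; rfl
      have hcomp' : ((MulAut.conj (a : G)⁻¹).toMonoidHom.comp (MulAut.conj (a : G)).toMonoidHom :
          G →* G) = MonoidHom.id G := by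
        ext x; simp [mul_assoc]
      change (H.map W.subtype).map (MulAut.conj ((a : G)⁻¹ * g)).toMonoidHom = _
      rw [hcomp, ← map_map, hconj, map_map, hcomp', map_id]
    rw [← mul_inv_cancel_left (a : G) g]
    exact mul_mem (mem_sup_right (hAF (mem_subgroupOf.mp ha))) (mem_sup_left hn)
  have hN : (H.map W.subtype).Normal := normalizer_eq_top_iff.mp (frattini_nongenerating hnorm)
  have hdisj : Disjoint A (H.map W.subtype) := by
    rw [disjoint_def]
    rintro _ hx ⟨y, hy, rfl⟩
    have := disjoint_def.mp hH.disjoint (x := y) (mem_subgroupOf.mpr hx) hy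
    simp [this]
  intro w hw
  obtain ⟨a, ha, h, hh, e⟩ : ∃ a ∈ A.subgroupOf W, ∃ h ∈ H, a * h = ⟨w, hw⟩ := by
    have := hH.sup_eq_top ▸ mem_top (⟨w, hw⟩ : W)
    rwa [mem_sup_of_normal_left] at this
  rw [mem_centralizer_iff]
  intro x hx
  have h1 : x * a = a * x := congrArg Subtype.val (mul_comm' (⟨x, hx⟩ : A) ⟨a, ha⟩)
  have h2 : x * h = h * x :=
    commute_of_normal_of_disjoint _ _ inferInstance hN hdisj x h hx ⟨h, hh, rfl⟩
  have e' : (a : G) * h = w := congrArg Subtype.val e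
  rw [← e', ← mul_assoc, h1, mul_assoc, h2, mul_assoc]

/-- If `A` is a normal subgroup inside the Frattini subgroup, every normal subgroup in which `A`
is a Hall subgroup acts trivially on the abelianization of `A`. -/
theorem commutator_mem_commutator_of_le_frattini {A W : Subgroup G} [A.Normal] [W.Normal]
    (hAW : A ≤ W) (hAF : A ≤ frattini G)
    (hcop : Nat.Coprime (Nat.card A) (A.relIndex W)) {w a : G} (hw : w ∈ W) (ha : a ∈ A) :
    ⁅w, a⁆ ∈ ⁅A, A⁆ := by
  let π := QuotientGroup.mk' ⁅A, A⁆
  have hπ : Function.Surjective π := QuotientGroup.mk'_surjective _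
  have hle : ⁅A, A⁆ ≤ A := commutator_le_left A A
  have : (A.map π).Normal := ‹A.Normal›.map π hπ
  have : (W.map π).Normal := ‹W.Normal›.map π hπ
  have hcomm : IsMulCommutative (A.map π) := by
    refine ⟨⟨?_⟩⟩
    rintro ⟨_, x, hx, rfl⟩ ⟨_, y, hy, rfl⟩
    refine Subtype.ext (?_ : π x * π y = π y * π x)
    rw [← commutatorElement_eq_one_iff_mul_comm, ← map_commutatorElement]
    exact (QuotientGroup.eq_one_iff _).mpr (commutator_mem_commutator hx hy)
  have hcop' : Nat.Coprime (Nat.card (A.map π)) ((A.map π).relIndex (W.map π)) := by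
    rw [relIndex_map_map, QuotientGroup.ker_mk', sup_eq_left.mpr hle,
      sup_eq_left.mpr (hle.trans hAW)]
    exact hcop.coprime_dvd_left (card_map_dvd A π)
  have hF : A.map π ≤ frattini (G ⧸ ⁅A, A⁆) :=
    map_le_iff_le_comap.mpr (hAF.trans (frattini_le_comap_frattini_of_surjective hπ))
  have h := mem_centralizer_iff.mp (le_centralizer_of_le_frattini (map_mono hAW) hF hcop'
    (mem_map_of_mem π hw)) (π a) (mem_map_of_mem π ha)
  rw [← QuotientGroup.eq_one_iff]
  change π ⁅w, a⁆ = 1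
  rw [map_commutatorElement, commutatorElement_eq_one_iff_mul_comm, h]

/-- A `p`-subgroup `A ≤ W` containing every `p`-element of `W` is a Hall subgroup of `W`. -/
theorem coprime_card_relIndex_of_isPGroup {p : ℕ} [Fact p.Prime] {A W : Subgroup G} (hAW : A ≤ W)
    (hA : IsPGroup p A) (h : ∀ x ∈ W, ∀ k, x ^ p ^ k = 1 → x ∈ A) :
    Nat.Coprime (Nat.card A) (A.relIndex W) := by
  let S : Sylow p W :=
    { toSubgroup := A.subgroupOf W
      isPGroup' := hA.of_equiv (subgroupOfEquivOfLe hAW).symm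
      is_maximal' := by
        intro Q hQ hle
        refine le_antisymm (fun x hx => ?_) hle
        obtain ⟨k, hk⟩ := hQ.exists_pow_pow_eq_one ⟨x, hx⟩
        refine mem_subgroupOf.mpr (h x x.2 k ?_)
        simpa [Subtype.ext_iff] using hk }
  have := S.card_coprime_index
  rwa [show Nat.card S = Nat.card A from
    Nat.card_congr (subgroupOfEquivOfLe hAW).toEquiv] at this

/-- The `p`-elements of the Frattini subgroup form a normal subgroup of the whole group. -/
theorem exists_normal_isPGroup_frattini (p : ℕ) [Fact p.Prime] :
    ∃ P : Subgroup G, P.Normal ∧ IsPGroup p P ∧ P ≤ frattini G ∧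
      ∀ x ∈ frattini G, ∀ k, x ^ p ^ k = 1 → x ∈ P := by
  obtain ⟨S⟩ : Nonempty (Sylow p (frattini G)) := inferInstance
  have hS : (S : Subgroup (frattini G)).Normal :=
by
    have h := (Group.isNilpotent_of_finite_tfae (G := frattini G)).out 0 3
    exact h.mp frattini_nilpotent p ‹_› S
  have := S.characteristic_of_normal hS
  refine ⟨(S : Subgroup (frattini G)).map (frattini G).subtype, inferInstance, S.2.map _,
    map_subtype_le _, fun x hx k hk => ?_⟩
  refine ⟨⟨x, hx⟩, ?_, rfl⟩
  have hz : IsPGroup p (zpowers (⟨x, hx⟩ : frattini G)) := by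
    obtain ⟨a, -, ha⟩ := (Nat.dvd_prime_pow Fact.out).mp
      (orderOf_dvd_of_pow_eq_one (x := (⟨x, hx⟩ : frattini G)) (Subtype.ext hk))
    exact IsPGroup.of_card ((Nat.card_zpowers _).trans ha)
  obtain ⟨T, hT⟩ := hz.exists_le_sylow
  have := S.unique_of_normal hS
  rw [Subsingleton.elim S T]
  exact hT (mem_zpowers _)

/-- A group of order divisible by `p` has a `p`-element `t` outside its Frattini subgroup, and
`t` can be chosen with its `p`-th power inside. -/
theorem exists_notMem_frattini_pow_mem {p : ℕ} [Fact p.Prime] (hp : p ∣ Nat.card G) :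
    ∃ t k, t ^ p ^ k = 1 ∧ t ∉ frattini G ∧ t ^ p ∈ frattini G := by
  obtain ⟨x, k, hk, hx⟩ : ∃ (x : G) (k : ℕ), x ^ p ^ k = 1 ∧ x ∉ frattini G := by
    by_contra! hall
    obtain ⟨P, hPn, hPp, hPF, hP⟩ := exists_normal_isPGroup_frattini (G := G) p
    have hcop := coprime_card_relIndex_of_isPGroup (W := ⊤) le_top hPp
      fun x _ k hk => hP x (hall x k hk) k hk
    rw [relIndex_top_right] at hcop
    obtain ⟨H, hH⟩ := exists_left_complement'_of_coprime hcop
    have hHtop : H = ⊤ := frattini_nongenerating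
      (eq_top_iff.mpr (hH.sup_eq_top ▸ sup_le_sup_left hPF H))
    obtain ⟨x, hx⟩ := exists_prime_orderOf_dvd_card' p hp
    have hxp : x ^ p ^ 1 = 1 := by rw [pow_one, ← hx, pow_orderOf_eq_one]
    have hx1 : x = 1 := disjoint_def.mp hH.disjoint (hHtop ▸ mem_top x) (hP x (hall x 1 hxp) 1 hxp)
    rw [hx1, orderOf_one] at hx
    exact (Fact.out : p.Prime).one_lt.ne hx
  induction k generalizing x with
  | zero => exact absurd (by simpa using hk) (fun h : x = 1 => hx (h ▸ one_mem _))
  | succ k ih =>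
    by_cases h : x ^ p ∈ frattini G
    · exact ⟨x, k + 1, hk, hx, h⟩
    · exact ih (x ^ p) (by rw [← pow_mul, ← pow_succ', hk]) h

/-- If `x` commutes with no nontrivial element of the normal subgroup `P`, then every element of
`P` is a commutator with `x`. -/
theorem exists_commutator_eq_of_forall_commute {P : Subgroup G} [P.Normal] {x : G}
    (hx : ∀ y ∈ P, Commute x y → y = 1) {z : G} (hz : z ∈ P) : ∃ y ∈ P, ⁅x, y⁆ = z := by
  let f : P → P := fun y => ⟨⁅x, (y : G)⁆, by
    rw [commutatorElement_def]
    exact mul_mem (‹P.Normal›.conj_mem _ y.2 x) (inv_mem y.2)⟩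
  have hf : Function.Injective f := by
    rintro ⟨y, hy⟩ ⟨w, hw⟩ hyw
    have e : x * y * x⁻¹ * y⁻¹ = x * w * x⁻¹ * w⁻¹ := congrArg Subtype.val hyw
    have hc : x * (w⁻¹ * y) = w⁻¹ * y * x := by
      have e' : x * y * x⁻¹ = x * w * x⁻¹ * w⁻¹ * y := by rw [← e]; group
      calc x * (w⁻¹ * y) = (x * w⁻¹ * x⁻¹) * (x * y * x⁻¹) * x := by group
        _ = w⁻¹ * y * x := by rw [e']; group
    have := hx _ (mul_mem (inv_mem hw) hy) hc
    exact Subtype.ext (inv_mul_eq_one.mp this).symm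
  obtain ⟨y, hy⟩ := Finite.surjective_of_injective hf ⟨z, hz⟩
  exact ⟨y, y.2, congrArg Subtype.val hy⟩

end Finite

end Subgroup

open Subgroup in
open scoped commutatorElement in
/-- Let `G` be a finite group and `q` an odd prime. If `G` contains an element whose order
is divisible by `2·q`, then there is `γ ∈ G \ Frat(G)` with `orderOf γ = 2 ^ a * q ^ b`
for some `a ≥ 1` and `b ≥ 1`. -/
theorem exists_nonFrattini_of_two_mul_odd_prime
    (G : Type*) [Group G] [Finite G] (q : ℕ) (hq : q.Prime) (hq2 : Odd q)
    (g : G) (hg : 2 * q ∣ orderOf g) :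
    ∃ γ : G, γ ∉ frattini G ∧
      ∃ a b : ℕ, 1 ≤ a ∧ 1 ≤ b ∧ orderOf γ = 2 ^ a * q ^ b := by
  by_contra! hcon
  have h : ∀ (γ : G) (a b : ℕ), 1 ≤ a → 1 ≤ b → orderOf γ = 2 ^ a * q ^ b → γ ∈ frattini G :=
    fun γ a b ha hb hγ => by_contra fun hn => hcon γ hn a b ha hb hγ
  have hne : 2 ≠ q := by rintro rfl; exact absurd hq2 (by decide)
  have : Fact q.Prime := ⟨hq⟩
  have two_frat {x z : G} {k l : ℕ} (hx : x ^ 2 ^ k = 1) (hz : z ^ q ^ l = 1) (hz1 : z ≠ 1)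
      (hxz : Commute x z) : x ∈ frattini G :=
    mem_frattini_of_commute Nat.prime_two hq hne h hx hz hz1 hxz
  have q_frat {x z : G} {k l : ℕ} (hx : x ^ q ^ k = 1) (hz : z ^ 2 ^ l = 1) (hz1 : z ≠ 1)
      (hxz : Commute x z) : x ∈ frattini G :=
    mem_frattini_of_commute hq Nat.prime_two hne.symm
      (fun γ a b ha hb hγ => h γ b a hb ha (by rw [hγ, mul_comm])) hx hz hz1 hxz
  obtain ⟨P, hPn, hPp, hPF, hP⟩ := exists_normal_isPGroup_frattini (G := G) 2
  obtain ⟨R, hRn, hRp, hRF, hR⟩ := exists_normal_isPGroup_frattini (G := G) q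
  have hPR : Disjoint P R := IsPGroup.disjoint_of_ne 2 q hne P R hPp hRp
  have hcomm : ∀ x ∈ P, ∀ y ∈ R, Commute x y := fun x hx y hy =>
    commute_of_normal_of_disjoint P R hPn hRn hPR x y hx hy
  have hPpow {x : G} (hx : x ∈ P) : ∃ k, x ^ 2 ^ k = 1 := by
    simpa [Subtype.ext_iff] using hPp.exists_pow_pow_eq_one ⟨x, hx⟩
  have hRpow {x : G} (hx : x ∈ R) : ∃ k, x ^ q ^ k = 1 := by
    simpa [Subtype.ext_iff] using hRp.exists_pow_pow_eq_one ⟨x, hx⟩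
  obtain ⟨u, z, hu, hz, huz⟩ : ∃ u z : G, orderOf u = 2 ∧ orderOf z = q ∧ Commute u z := by
    have h0 := (orderOf_pos g).ne'
    refine ⟨g ^ (orderOf g / 2), g ^ (orderOf g / q), ?_, ?_, (Commute.refl g).pow_pow _ _⟩
    · exact orderOf_pow_orderOf_div h0 ((dvd_mul_right 2 q).trans hg)
    · exact orderOf_pow_orderOf_div h0 ((dvd_mul_left q 2).trans hg)
  have hu2 : u ^ 2 ^ 1 = 1 := by rw [pow_one, ← hu, pow_orderOf_eq_one]
  have hzq : z ^ q ^ 1 = 1 := by rw [pow_one]; exact hz ▸ pow_orderOf_eq_one z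
  have hu1 : u ≠ 1 := by rintro rfl; simp at hu
  have hz1 : z ≠ 1 := by rintro rfl; rw [orderOf_one] at hz; exact hq.one_lt.ne hz
  have huP : u ∈ P := hP u (two_frat hu2 hzq hz1 huz) 1 hu2
  have hzR : z ∈ R := hR z (q_frat hzq hu2 hu1 huz.symm) 1 hzq
  -- the centralizer of `R` has `P` as its Sylow `2`-subgroup and `R` as its Sylow `q`-subgroup
  let K : Subgroup G := centralizer R
  have hK {x : G} : x ∈ K ↔ ∀ y ∈ R, Commute y x := mem_centralizer_iff
  have hPK : P ≤ K := fun x hx => hK.mpr fun y hy => (hcomm x hx y hy).symm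
  have hcopP : Nat.Coprime (Nat.card P) (P.relIndex K) :=
    coprime_card_relIndex_of_isPGroup hPK hPp fun x hx k hk =>
      hP x (two_frat hk hzq hz1 (hK.mp hx z hzR).symm) k hk
  have hKq : ∀ x ∈ K, ∀ k, x ^ q ^ k = 1 → x ∈ R := by
    intro x hx k hk
    refine hR x (by_contra fun hxF => ?_) k hk
    have hfree : ∀ y ∈ P, Commute x y → y = 1 := by
      intro y hy hxy
      obtain ⟨l, hl⟩ := hPpow hy
      exact by_contra fun hy1 => hxF (q_frat hk hl hy1 hxy)
    have hle : P ≤ ⁅P, P⁆ := by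
      intro y hy
      obtain ⟨w, hw, rfl⟩ := exists_commutator_eq_of_forall_commute hfree hy
      exact commutator_mem_commutator_of_le_frattini hPK hPF hcopP hx hw
    have hnil : Group.IsNilpotent P := hPp.isNilpotent
    have : Nontrivial P := ⟨⟨⟨u, huP⟩, 1, fun e => hu1 (congrArg Subtype.val e)⟩⟩
    have hlt := Group.IsSolvable.commutator_lt_top_of_nontrivial P
    refine hlt.ne (map_injective P.subtype_injective ?_)
    rw [map_subtype_commutator, ← MonoidHom.range_eq_map, range_subtype]
    exact le_antisymm (commutator_le_left P P) hle
  -- a `2`-element outside the Frattini subgroup inverts `R`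
  obtain ⟨t, k, htk, htF, ht2⟩ := exists_notMem_frattini_pow_mem (G := G) (p := 2)
    (hu ▸ orderOf_dvd_natCard u)
  have htt : t ^ 2 ∈ K := hPK (hP _ ht2 k (by rw [← pow_mul, mul_comm, pow_mul, htk, one_pow]))
  have htinv : ∀ y ∈ R, t * y * t⁻¹ = y⁻¹ := by
    intro y hy
    have hfree : ∀ y ∈ R, Commute t y → y = 1 := by
      intro y hy hty
      obtain ⟨l, hl⟩ := hRpow hy
      exact by_contra fun hy1 => htF (two_frat htk hl hy1 hty)
    obtain ⟨w, hw, rfl⟩ := exists_commutator_eq_of_forall_commute hfree hy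
    have e : t ^ 2 * w * (t ^ 2)⁻¹ = w := by
      rw [← (hK.mp htt w hw).eq, mul_inv_cancel_right]
    rw [commutatorElement_def]
    calc t * (t * w * t⁻¹ * w⁻¹) * t⁻¹ = (t ^ 2 * w * (t ^ 2)⁻¹) * (t * w * t⁻¹)⁻¹ := by
          rw [pow_two]; group
      _ = (t * w * t⁻¹ * w⁻¹)⁻¹ := by rw [e]; group
  have hRcomm : ∀ x ∈ R, ∀ y ∈ R, x * y = y * x := by
    intro x hx y hy
    have e : (x * y)⁻¹ = x⁻¹ * y⁻¹ := by
      rw [← htinv _ (mul_mem hx hy), ← htinv x hx, ← htinv y hy]; group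
    rw [← inv_inj, e, mul_inv_rev]
  have : IsMulCommutative R := ⟨⟨fun x y => Subtype.ext (hRcomm x x.2 y y.2)⟩⟩
  obtain ⟨W, hWn, hW⟩ := exists_normal_mem_iff_centralizes_or_inverts R
  have hRK : R ≤ K := fun x hx => hK.mpr fun y hy => hRcomm y hy x hx
  have hRW : R ≤ W := fun x hx => (hW x).mpr (Or.inl (hRK hx))
  have hWsq : ∀ x ∈ W, x ^ 2 ∈ K := by
    intro x hx
    rcases (hW x).mp hx with hx | hx
    · exact pow_mem hx 2
    · refine hK.mpr fun y hy => ?_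
      have e : x * (x * y * x⁻¹) * x⁻¹ = y := by rw [hx y hy, hx _ (inv_mem hy), inv_inv]
      calc y * x ^ 2 = x * (x * y * x⁻¹) * x⁻¹ * x ^ 2 := by rw [e]
        _ = x ^ 2 * y := by rw [pow_two]; group
  have hcopR : Nat.Coprime (Nat.card R) (R.relIndex W) :=
    coprime_card_relIndex_of_isPGroup hRW hRp fun x hx k hk => by
      refine hKq x ?_ k hk
      obtain ⟨m, hm⟩ := exists_pow_eq_self_of_coprime (x := x) (n := 2)
        ((Nat.Coprime.pow_right k ((Nat.coprime_primes Nat.prime_two hq).mpr hne)).coprime_dvd_right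
          (orderOf_dvd_of_pow_eq_one hk))
      exact hm ▸ pow_mem (hWsq x hx) m
  have htK : t ∈ K := le_centralizer_of_le_frattini hRW hRF hcopR ((hW t).mpr (Or.inr htinv))
  exact htF (two_frat htk hzq hz1 (hK.mp htK z hzR).symm)
end

section
/- Let G be a finite group and let p be a prime dividing |G|. Then there exists an element g ∈ G \ Frat(G) whose order is divisible by p. -/
/-- A Sylow subgroup of a finite group that is contained in the Frattini subgroup is trivial. -/
theorem Sylow.eq_bot_of_le_frattini {G : Type*} [Group G] [Finite G] {p : ℕ} [Fact p.Prime]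
    (P : Sylow p G) (hP : (P : Subgroup G) ≤ frattini G) : (P : Subgroup G) = ⊥ := by
  have : (P : Subgroup G).Normal :=
    Subgroup.normalizer_eq_top_iff.mp (frattini_nongenerating (P.normalizer_sup_eq_top' hP))
  obtain ⟨K, hK⟩ := Subgroup.exists_right_complement'_of_coprime P.card_coprime_index
  have hK_top : K = ⊤ := frattini_nongenerating <| top_le_iff.mp <|
    hK.symm.sup_eq_top.ge.trans (sup_le_sup_left hP K)
  exact disjoint_top.mp (hK_top ▸ hK.disjoint)

/-- If `p` is a prime dividing the order of a finite group `G`, then some element of `G`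
outside the Frattini subgroup has order divisible by `p`. -/
theorem exists_nonFrattini_dvd_orderOf
    (G : Type*) [Group G] [Finite G] (p : ℕ) (hp : p.Prime) (hpG : p ∣ Nat.card G) :
    ∃ g : G, g ∉ frattini G ∧ p ∣ orderOf g := by
  have : Fact p.Prime := ⟨hp⟩
  obtain ⟨P⟩ : Nonempty (Sylow p G) := inferInstance
  have hP : ¬(P : Subgroup G) ≤ frattini G := fun h ↦
    P.ne_bot_of_dvd_card hpG (P.eq_bot_of_le_frattini h)
  obtain ⟨g, hgP, hg⟩ := SetLike.not_le_iff_exists.mp hP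
  obtain ⟨k, hk⟩ := IsPGroup.iff_orderOf.mp P.isPGroup' ⟨g, hgP⟩
  rw [Subgroup.orderOf_mk] at hk
  refine ⟨g, hg, hk ▸ dvd_pow_self p ?_⟩
  rintro rfl
  rw [pow_zero, orderOf_eq_one_iff] at hk
  exact hg (hk ▸ one_mem _)
end

section
/- Let G be the dicyclic group of order 12 (the group with presentation ⟨a, b ∣ a³ = 1, b⁴ = 1, b⁻¹ab = a⁻¹⟩, i.e., QuaternionGroup 3 in Mathlib). Then G contains an element of order 6, but the quotient G / Frat(G) contains no element of order 6. In particular, the prime graphs Γ(G) and Γ(G/Frat(G)) do not coincide. -/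
namespace QuaternionGroup

theorem a_mem_zpowers_a_one {n : ℕ} [NeZero n] (i : ZMod (2 * n)) :
    a i ∈ Subgroup.zpowers (a 1 : QuaternionGroup n) :=
  Subgroup.mem_zpowers_iff.mpr ⟨(i.val : ℕ), by
    rw [zpow_natCast, a_one_pow, ZMod.natCast_zmod_val]⟩

theorem zpowers_a_one_ne_top (n : ℕ) [NeZero n] :
    Subgroup.zpowers (a 1 : QuaternionGroup n) ≠ ⊤ := by
  intro h
  have hcard := Nat.card_zpowers (a 1 : QuaternionGroup n)
  rw [h, Subgroup.card_top, Nat.card_eq_fintype_card, card, orderOf_a_one] at hcard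
  have := NeZero.ne n
  omega

/-- The central involution of a dicyclic group lies in the Frattini subgroup: a maximal subgroup
either contains some `xa i`, whose square is `a n`, or equals the cyclic subgroup generated by
`a 1`. -/
theorem a_natCast_mem_frattini (n : ℕ) [NeZero n] :
    (a n : QuaternionGroup n) ∈ frattini (QuaternionGroup n) := by
  simp only [frattini, Order.radical, Subgroup.mem_iInf]
  intro M hM
  by_contra hn
  have hle : M ≤ Subgroup.zpowers (a 1) := by
    rintro (i | i) hi
    · exact a_mem_zpowers_a_one i
    · exact absurd (xa_sq i ▸ M.pow_mem hi 2) hn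
  rcases hM.le_iff.mp hle with h | h
  · exact zpowers_a_one_ne_top n h
  · exact hn (h ▸ a_mem_zpowers_a_one _)

/-- In the dicyclic group of order 12, every element has its square or its cube in the Frattini
subgroup. -/
theorem sq_mem_or_cube_mem_frattini (g : QuaternionGroup 3) :
    g ^ 2 ∈ frattini (QuaternionGroup 3) ∨ g ^ 3 ∈ frattini (QuaternionGroup 3) := by
  have h := a_natCast_mem_frattini 3
  rcases g with i | i
  · right
    have hi : (a i : QuaternionGroup 3) ^ 3 = 1 ∨ (a i : QuaternionGroup 3) ^ 3 = a (3 : ℕ) := by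
      revert i
      decide
    rcases hi with hi | hi <;> rw [hi]
    exacts [one_mem _, h]
  · left
    rwa [xa_sq]

end QuaternionGroup

/-- The dicyclic group `G` of order 12 (`QuaternionGroup 3`) contains an element of
order 6, but its quotient by the Frattini subgroup contains no element of order 6.
In particular the prime graphs of `G` and `G/Frat(G)` do not coincide. -/
theorem quaternionGroup_three_frattini_quotient_no_order_six :
    (∃ g : QuaternionGroup 3, orderOf g = 6) ∧
      ∀ x : QuaternionGroup 3 ⧸ frattini (QuaternionGroup 3), orderOf x ≠ 6 := by
  refine ⟨⟨.a 1, QuaternionGroup.orderOf_a_one⟩, fun x hx ↦ ?_⟩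
  obtain ⟨g, rfl⟩ := QuotientGroup.mk_surjective x
  rcases QuaternionGroup.sq_mem_or_cube_mem_frattini g with h | h <;>
  · rw [← QuotientGroup.eq_one_iff, QuotientGroup.mk_pow] at h
    have hdvd := orderOf_dvd_of_pow_eq_one h
    rw [hx] at hdvd
    norm_num at hdvd
end

section
/- Let p and q be distinct primes and let G be a finite group whose Frattini subgroup F = Frat(G) is an internal direct product F = P × Q, where P is the Sylow p-subgroup of F and Q is the Sylow q-subgroup of F. Assume that: (1) the quotient G/F contains no element whose order is divisible by p·q; (4) for every element y ∈ G of q-power order, if y centralizes some nontrivial element of P then y ∈ Q; and (5) for every element x ∈ G of p-power order, if x centralizes some nontrivial element of Q then x ∈ P. Then every element of G whose order is of the form p^a · q^b with a ≥ 1 and b ≥ 1 lies in F; that is, Ω**_{p,q}(G) = ∅. -/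
/-- An element of `P ⊔ Q`, with `P` a `p`-group and `Q` normal, whose order is coprime to `p`
lies in `Q`. -/
theorem IsPGroup.mem_of_mem_sup_of_coprime_orderOf {G : Type*} [Group G] {p : ℕ}
    {P Q : Subgroup G} [Q.Normal] (hP : IsPGroup p P) {y : G} (hy : y ∈ P ⊔ Q)
    (hcop : (orderOf y).Coprime p) : y ∈ Q := by
  obtain ⟨u, hu, v, hv, rfl⟩ := Subgroup.mem_sup_of_normal_right.mp hy
  obtain ⟨k, hk⟩ := hP ⟨u, hu⟩
  have huk : u ^ p ^ k = 1 := congrArg Subtype.val hk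
  have hmk : QuotientGroup.mk' Q (u * v) = QuotientGroup.mk' Q u := by
    have hv' : QuotientGroup.mk' Q v = 1 := (QuotientGroup.eq_one_iff v).mpr hv
    rw [map_mul, hv', mul_one]
  have h₁ : orderOf (QuotientGroup.mk' Q (u * v)) ∣ orderOf (u * v) := orderOf_map_dvd _ _
  have h₂ : orderOf (QuotientGroup.mk' Q (u * v)) ∣ p ^ k := by
    rw [hmk, orderOf_dvd_iff_pow_eq_one, ← map_pow, huk, map_one]
  exact (QuotientGroup.eq_one_iff _).mp
    (orderOf_eq_one_iff.mp (Nat.eq_one_of_dvd_coprimes (hcop.pow_right k) h₁ h₂))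

/-- If an element of order `p ^ a * q ^ b` has image of order prime to `q` modulo the normal
subgroup `F = P ⊔ Q`, and `p`-elements centralizing a nontrivial element of `Q` lie in `P`, then the
element lies in `F`. -/
theorem mem_of_sup_eq_of_not_dvd_orderOf_mk {G : Type*} [Group G] {p q : ℕ} (hp : p.Prime)
    (hq : q.Prime) (hpq : p ≠ q) {P Q : Subgroup G} [Q.Normal] {F : Subgroup G} [F.Normal]
    (hP : IsPGroup p P) (hsup : P ⊔ Q = F)
    (hcent : ∀ x : G, (∃ a : ℕ, orderOf x = p ^ a) →
      (∃ y ∈ Q, y ≠ 1 ∧ Commute x y) → x ∈ P)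
    {g : G} {a b : ℕ} (hb : 1 ≤ b) (hg : orderOf g = p ^ a * q ^ b)
    (hdvd : ¬ q ∣ orderOf (g : G ⧸ F)) : g ∈ F := by
  have hcop : (p ^ a).Coprime (q ^ b) := Nat.coprime_pow_primes a b hp hq hpq
  have hpa : p ^ a ≠ 0 := pow_ne_zero _ hp.ne_zero
  have hqb : q ^ b ≠ 0 := pow_ne_zero _ hq.ne_zero
  have hx : orderOf (g ^ q ^ b) = p ^ a := by
    rw [orderOf_pow_of_dvd hqb (hg ▸ dvd_mul_left _ _), hg,
      Nat.mul_div_cancel _ (Nat.pos_of_ne_zero hqb)]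
  have hy : orderOf (g ^ p ^ a) = q ^ b := by
    rw [orderOf_pow_of_dvd hpa (hg ▸ dvd_mul_right _ _), hg,
      Nat.mul_div_cancel_left _ (Nat.pos_of_ne_zero hpa)]
  have hmk : orderOf (g : G ⧸ F) ∣ p ^ a := by
    have h : orderOf (g : G ⧸ F) ∣ p ^ a * q ^ b :=
      hg ▸ orderOf_map_dvd (QuotientGroup.mk' F) g
    exact (((hq.coprime_iff_not_dvd.mpr hdvd).symm).pow_right b).dvd_of_dvd_mul_right h
  have hy_mem : g ^ p ^ a ∈ F := by
    rw [← QuotientGroup.eq_one_iff, QuotientGroup.mk_pow]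
    exact orderOf_dvd_iff_pow_eq_one.mp hmk
  have hyQ : g ^ p ^ a ∈ Q := hP.mem_of_mem_sup_of_coprime_orderOf (hsup ▸ hy_mem)
    (hy ▸ ((Nat.coprime_primes hq hp).mpr hpq.symm).pow_left b)
  have hy_ne : g ^ p ^ a ≠ 1 := by
    rw [Ne, ← orderOf_eq_one_iff, hy]
    exact (Nat.one_lt_pow (by omega) hq.one_lt).ne'
  have hxP : g ^ q ^ b ∈ P :=
    hcent _ ⟨a, hx⟩ ⟨_, hyQ, hy_ne, (Commute.refl g).pow_pow _ _⟩
  have hmk' : orderOf (g : G ⧸ F) ∣ q ^ b := by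
    rw [orderOf_dvd_iff_pow_eq_one, ← QuotientGroup.mk_pow, QuotientGroup.eq_one_iff]
    exact hsup ▸ Subgroup.mem_sup_left hxP
  exact (QuotientGroup.eq_one_iff g).mp
    (orderOf_eq_one_iff.mp (Nat.eq_one_of_dvd_coprimes hcop hmk hmk'))

/-- Let `p ≠ q` be primes and `G` a finite group whose Frattini subgroup is the internal
direct product of a normal `p`-subgroup `P` and a normal `q`-subgroup `Q` (so `P` and `Q`
are the Sylow `p`- and `q`-subgroups of `Frat(G)`).  Assume:
(1) no element of `G/Frat(G)` has order divisible by `p·q`;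
(4) every element of `q`-power order of `G` centralizing a nontrivial element of `P`
    lies in `Q`;
(5) every element of `p`-power order of `G` centralizing a nontrivial element of `Q`
    lies in `P`.
Then every element of `G` of order `p^a·q^b` with `a, b ≥ 1` lies in `Frat(G)`,
i.e. `Ω**_{p,q}(G) = ∅`. -/
theorem frattini_triple_extension_omega_star_star_empty
    (G : Type*) [Group G] [Finite G] (p q : ℕ) (hp : p.Prime) (hq : q.Prime) (hpq : p ≠ q)
    (P Q : Subgroup G) (hPn : P.Normal) (hQn : Q.Normal)
    (hPp : IsPGroup p P) (hQq : IsPGroup q Q)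
    (hsup : P ⊔ Q = frattini G) (hinf : P ⊓ Q = ⊥)
    (h1 : ∀ x : G ⧸ frattini G, ¬ p * q ∣ orderOf x)
    (h4 : ∀ y : G, (∃ b : ℕ, orderOf y = q ^ b) →
      (∃ x ∈ P, x ≠ 1 ∧ Commute y x) → y ∈ Q)
    (h5 : ∀ x : G, (∃ a : ℕ, orderOf x = p ^ a) →
      (∃ y ∈ Q, y ≠ 1 ∧ Commute x y) → x ∈ P) :
    ∀ g : G, (∃ a b : ℕ, 1 ≤ a ∧ 1 ≤ b ∧ orderOf g = p ^ a * q ^ b) →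
      g ∈ frattini G := by
  rintro g ⟨a, b, ha, hb, hg⟩
  by_cases hdvd : q ∣ orderOf (g : G ⧸ frattini G)
  · have hdvd' : ¬ p ∣ orderOf (g : G ⧸ frattini G) := fun h =>
      h1 g (((Nat.coprime_primes hp hq).mpr hpq).mul_dvd_of_dvd_of_dvd h hdvd)
    exact mem_of_sup_eq_of_not_dvd_orderOf_mk hq hp hpq.symm hQq (sup_comm P Q ▸ hsup) h4 ha
      (hg.trans (mul_comm _ _)) hdvd'
  · exact mem_of_sup_eq_of_not_dvd_orderOf_mk hp hq hpq hPp hsup h5 hb hg hdvd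
end

section
/- Let p and q be distinct odd primes, and let G be a finite group of minimal order with respect to the property that G contains an element whose order is divisible by p·q but every element of G \ Frat(G) has order divisible by some prime other than p and q (i.e., Ω_{p,q}(G) ≠ ∅ and Ω**_{p,q}(G) = ∅). Let P be the Sylow p-subgroup and Q the Sylow q-subgroup of Frat(G), and set X = G/Frat(G), so that P is an 𝔽_p[X]-module and Q is an 𝔽_q[X]-module via conjugation. Then the second group cohomology groups H²(X, P) and H²(X, Q) are both nonzero. -/
/-- `Ω_{p,q}(G) ≠ ∅` and `Ω**_{p,q}(G) = ∅`: `G` has an element of order divisible by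
`p·q`, but every element of `G` whose order is divisible by `p·q` and by no prime other
than `p` and `q` lies in the Frattini subgroup. -/
def OmegaBad (p q : ℕ) (G : Type*) [Group G] : Prop :=
  (∃ g : G, p * q ∣ orderOf g) ∧
    ∀ g : G, (p * q ∣ orderOf g ∧ ∀ r : ℕ, r.Prime → r ∣ orderOf g → r = p ∨ r = q) →
      g ∈ frattini G

open groupCohomology in
/-- If `H²(X, V)` vanishes, then every extension of `X` by the module `V` splits. -/
theorem exists_section_of_subsingleton_H2 {k X V : Type} {E : Type*} [CommRing k] [Group X]
    [AddCommGroup V] [Module k V] [Group E] (ρ : Representation k X V)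
    [Subsingleton (H2 (Rep.of ρ))] (φ : Multiplicative V →* E) (ψ : E →* X)
    (hφ : Function.Injective φ) (hψ : Function.Surjective ψ) (hker : ψ.ker ≤ φ.range)
    (hφψ : ∀ v, ψ (φ v) = 1)
    (hconj : ∀ (g : E) (v : V),
      φ (Multiplicative.ofAdd (ρ (ψ g) v)) = g * φ (Multiplicative.ofAdd v) * g⁻¹) :
    ∃ t : X →* E, ∀ x, ψ (t x) = x := by
  choose s hs using hψ
  have hc : ∀ z : X × X, ∃ v : V,
      φ (Multiplicative.ofAdd v) * s (z.1 * z.2) = s z.1 * s z.2 := by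
    rintro ⟨x, y⟩
    obtain ⟨v, hv⟩ := hker (x := s x * s y * (s (x * y))⁻¹) (by simp [MonoidHom.mem_ker, hs])
    exact ⟨v.toAdd, by simp [hv]⟩
  choose c hc using hc
  have hconj' : ∀ (x : X) (v : V),
      φ (Multiplicative.ofAdd (ρ x v)) * s x = s x * φ (Multiplicative.ofAdd v) := by
    intro x v
    have := hconj (s x) v
    rw [hs] at this
    simp [this]
  have hcocycle : c ∈ cocycles₂ (Rep.of ρ) := by
    rw [mem_cocycles₂_iff]
    intro x y z
    change c (x * y, z) + c (x, y) = ρ x (c (y, z)) + c (x, y * z)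
    apply Multiplicative.ofAdd.injective
    apply hφ
    apply mul_right_cancel (b := s (x * y * z))
    have h₁ := hc (x, y)
    have h₂ := hc (x * y, z)
    have h₃ := hc (y, z)
    have h₄ := hc (x, y * z)
    have h₅ := hconj' x (c (y, z))
    dsimp only at h₁ h₂ h₃ h₄
    rw [add_comm (c (x * y, z)), ofAdd_add, ofAdd_add, map_mul, map_mul, mul_assoc (φ _), h₂,
      ← mul_assoc, h₁, mul_assoc x, mul_assoc (φ _), h₄, ← mul_assoc, h₅, mul_assoc, mul_assoc, h₃]
  have hcob : c ∈ coboundaries₂ (Rep.of ρ) :=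
    (H2π_eq_zero_iff (⟨c, hcocycle⟩ : cocycles₂ (Rep.of ρ))).1 (Subsingleton.elim _ _)
  obtain ⟨b, hb⟩ := hcob
  have hb' : ∀ x y : X, c (x, y) = ρ x (b y) - b (x * y) + b x := fun x y =>
    (congrFun hb (x, y)).symm
  refine ⟨MonoidHom.mk' (fun x => φ (Multiplicative.ofAdd (-b x)) * s x) fun x y => ?_,
    fun x => by simp [hφψ, hs]⟩
  have h₁ := hc (x, y)
  have h₂ := hconj' x (-b y)
  dsimp only at h₁
  rw [mul_assoc (φ _) (s x), ← mul_assoc (s x), ← h₂, mul_assoc (φ _) (s x), ← h₁, ← mul_assoc,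
    ← mul_assoc, ← map_mul, ← map_mul, ← ofAdd_add, ← ofAdd_add, hb']
  congr 3
  rw [map_neg]
  abel

/-- If the Frattini subgroup of a finite group `G` is an internal direct product `P × Q` with
`P` nontrivial and abelian, then `H²(G / Frat(G), P)` is nonzero. -/
theorem nontrivial_H2_of_frattini_eq_sup {k G V : Type} [CommRing k] [Group G] [Finite G]
    (P Q : Subgroup G) (hPn : P.Normal) (hQn : Q.Normal) (hP : P ≠ ⊥)
    (hsup : P ⊔ Q = frattini G) (hinf : P ⊓ Q = ⊥) [AddCommGroup V] [Module k V]
    (ρ : Representation k (G ⧸ frattini G) V)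
    (e : ↥P ≃ V) (he : ∀ x y : ↥P, e (x * y) = e x + e y)
    (heq : ∀ (g : G) (x : ↥P),
      ρ (QuotientGroup.mk g) (e x) = e ⟨g * ↑x * g⁻¹, hPn.conj_mem ↑x x.2 g⟩) :
    Nontrivial (groupCohomology.H2 (Rep.of ρ)) := by
  by_contra hH
  rw [not_nontrivial_iff_subsingleton] at hH
  have hPF : P ≤ frattini G := hsup ▸ le_sup_left
  have hQF : Q ≤ frattini G := hsup ▸ le_sup_right
  let e' : P ≃* Multiplicative V := MulEquiv.mk' (e.trans Multiplicative.ofAdd) he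
  let φ : Multiplicative V →* G ⧸ Q :=
    (QuotientGroup.mk' Q).comp (P.subtype.comp e'.symm.toMonoidHom)
  let ψ : G ⧸ Q →* G ⧸ frattini G := QuotientGroup.map Q (frattini G) (MonoidHom.id G) hQF
  have hφe : ∀ x : P, φ (e' x) = QuotientGroup.mk (x : G) := fun x => by simp [φ]
  obtain ⟨t, ht⟩ := exists_section_of_subsingleton_H2 ρ φ ψ
    (by
      rw [injective_iff_map_eq_one]
      intro v hv
      obtain ⟨x, rfl⟩ := e'.surjective v
      rw [hφe, QuotientGroup.eq_one_iff] at hv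
      have : (x : G) ∈ P ⊓ Q := ⟨x.2, hv⟩
      rw [hinf, Subgroup.mem_bot, OneMemClass.coe_eq_one] at this
      simp [this])
    (by
      intro x
      obtain ⟨g, rfl⟩ := QuotientGroup.mk_surjective x
      exact ⟨QuotientGroup.mk g, rfl⟩)
    (by
      intro x hx
      obtain ⟨g, rfl⟩ := QuotientGroup.mk_surjective x
      have hg : g ∈ P ⊔ Q := hsup ▸ (QuotientGroup.eq_one_iff g).1 hx
      obtain ⟨a, ha, b, hb, rfl⟩ := Subgroup.mem_sup_of_normal_right.1 hg
      refine ⟨e' ⟨a, ha⟩, ?_⟩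
      rw [hφe, QuotientGroup.eq]
      simpa using hb)
    (by
      intro v
      obtain ⟨x, rfl⟩ := e'.surjective v
      rw [hφe]
      exact (QuotientGroup.eq_one_iff _).2 (hPF x.2))
    (by
      intro g v
      obtain ⟨g, rfl⟩ := QuotientGroup.mk_surjective g
      obtain ⟨x, rfl⟩ := e.surjective v
      change φ (Multiplicative.ofAdd (ρ (QuotientGroup.mk g) (e x))) = _
      rw [heq]
      exact (hφe _).trans (congrArg (fun y => QuotientGroup.mk g * y * (QuotientGroup.mk g)⁻¹)
        (hφe x).symm))
  have htop : t.range.comap (QuotientGroup.mk' Q) = ⊤ := by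
    apply frattini_nongenerating
    rw [eq_top_iff]
    intro g _
    obtain ⟨m, hm⟩ := QuotientGroup.mk_surjective (t (QuotientGroup.mk g))
    have hmg : (m : G ⧸ frattini G) = g := by
      rw [← ht (QuotientGroup.mk g), ← hm]
      rfl
    rw [← mul_inv_cancel_left m g]
    exact Subgroup.mul_mem_sup ⟨_, hm.symm⟩ (QuotientGroup.eq.1 hmg)
  apply hP
  rw [eq_bot_iff, ← hinf]
  refine fun a ha => ⟨ha, ?_⟩
  have hat : a ∈ t.range.comap (QuotientGroup.mk' Q) := htop ▸ Subgroup.mem_top a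
  obtain ⟨x, hx⟩ := hat
  have hx1 : x = 1 := by
    rw [← ht x, hx]
    exact (QuotientGroup.eq_one_iff a).2 (hPF ha)
  rw [hx1, map_one] at hx
  exact (QuotientGroup.eq_one_iff a).1 hx.symm

theorem OmegaBad.symm {p q : ℕ} {G : Type*} [Group G] (h : OmegaBad p q G) : OmegaBad q p G := by
  refine ⟨by simpa only [mul_comm] using h.1, fun g hg => h.2 g ⟨?_, fun r hr hrg => ?_⟩⟩
  · simpa only [mul_comm] using hg.1
  · exact (hg.2 r hr hrg).symm

/-- In a group with `Ω_{p,q}(G) ≠ ∅` and `Ω**_{p,q}(G) = ∅`, the Frattini subgroup is not a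
`q`-group. -/
theorem OmegaBad.not_isPGroup_frattini {p q : ℕ} {G : Type*} [Group G] [Finite G]
    (h : OmegaBad p q G) (hp : p.Prime) (hq : q.Prime) (hpq : p ≠ q) :
    ¬ IsPGroup q (frattini G) := by
  intro hF
  obtain ⟨g, hg⟩ := h.1
  have hord := orderOf_pow_orderOf_div (orderOf_pos g).ne' hg
  have hmem := h.2 (g ^ (orderOf g / (p * q))) (by
    rw [hord]
    refine ⟨dvd_rfl, fun r hr hrd => ?_⟩
    rwa [hr.dvd_mul, Nat.prime_dvd_prime_iff_eq hr hp, Nat.prime_dvd_prime_iff_eq hr hq] at hrd)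
  obtain ⟨n, hn⟩ := hF ⟨_, hmem⟩
  have hdvd : p * q ∣ q ^ n := hord ▸ orderOf_dvd_of_pow_eq_one (congrArg Subtype.val hn)
  exact hpq ((Nat.prime_dvd_prime_iff_eq hp hq).1
    (hp.dvd_of_dvd_pow ((dvd_mul_right p q).trans hdvd)))

/-- Let `p, q` be distinct odd primes and `G` a finite group of minimal order subject to
`Ω_{p,q}(G) ≠ ∅` and `Ω**_{p,q}(G) = ∅`.  Let `P` and `Q` be the Sylow `p`- and Sylow
`q`-subgroups of `Frat(G)` (so `Frat(G) = P × Q`), regarded as modules over `𝔽_p` and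
`𝔽_q` respectively for `X = G/Frat(G)` acting by conjugation: that is, `V` (resp. `W`)
is an `𝔽_p[X]`-module (resp. `𝔽_q[X]`-module) whose additive group is identified with
`P` (resp. `Q`) via `e` (resp. `f`) in a conjugation-equivariant way.  Then the second
cohomology groups `H²(X, P)` and `H²(X, Q)` are both nonzero. -/
theorem minimal_omegaBad_h2_ne_zero
    (G : Type) [Group G] [Finite G] (p q : ℕ)
    (hp : p.Prime) (hq : q.Prime) (hpodd : Odd p) (hqodd : Odd q) (hpq : p ≠ q)
    (hbad : OmegaBad p q G)
    (hmin : ∀ (H : Type) [Group H] [Finite H], OmegaBad p q H → Nat.card G ≤ Nat.card H)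
    (P Q : Subgroup G) (hPn : P.Normal) (hQn : Q.Normal)
    (hPp : IsPGroup p P) (hQq : IsPGroup q Q)
    (hsup : P ⊔ Q = frattini G) (hinf : P ⊓ Q = ⊥)
    (V : Type) [AddCommGroup V] [Module (ZMod p) V]
    (ρ : Representation (ZMod p) (G ⧸ frattini G) V)
    (e : ↥P ≃ V) (he : ∀ x y : ↥P, e (x * y) = e x + e y)
    (heq : ∀ (g : G) (x : ↥P),
      ρ (QuotientGroup.mk g) (e x) = e ⟨g * ↑x * g⁻¹, hPn.conj_mem ↑x x.2 g⟩)
    (W : Type) [AddCommGroup W] [Module (ZMod q) W]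
    (σ : Representation (ZMod q) (G ⧸ frattini G) W)
    (f : ↥Q ≃ W) (hf : ∀ x y : ↥Q, f (x * y) = f x + f y)
    (hfq : ∀ (g : G) (x : ↥Q),
      σ (QuotientGroup.mk g) (f x) = f ⟨g * ↑x * g⁻¹, hQn.conj_mem ↑x x.2 g⟩) :
    Nontrivial (groupCohomology.H2 (Rep.of ρ)) ∧
      Nontrivial (groupCohomology.H2 (Rep.of σ)) := by
  have hP : P ≠ ⊥ := by
    rintro rfl
    rw [bot_sup_eq] at hsup
    exact hbad.not_isPGroup_frattini hp hq hpq (hsup ▸ hQq)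
  have hQ : Q ≠ ⊥ := by
    rintro rfl
    rw [sup_bot_eq] at hsup
    exact hbad.symm.not_isPGroup_frattini hq hp hpq.symm (hsup ▸ hPp)
  exact ⟨nontrivial_H2_of_frattini_eq_sup P Q hPn hQn hP hsup hinf ρ e he heq,
    nontrivial_H2_of_frattini_eq_sup Q P hQn hPn hQ (sup_comm P Q ▸ hsup) (inf_comm P Q ▸ hinf)
      σ f hf hfq⟩
end
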